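/- arXiv:1507.03843 — 3 statements merged into one kernel-verified Lean document; each statement's English description precedes it below -/
import Mathlib

section
/- Let n ≥ 1 be an integer, let S₁, …, S_n be i.i.d. random variables with the exponential distribution of mean 1, and let t ∈ (0,1]. Then for every x ∈ [0,∞)^n with Σ_{i=1}^n x_i ≤ 1: P[ Σ_{i=1}^n x_i·S_i ≤ t ] ≥ P[ (1/n)·Σ_{i=1}^n S_i ≤ t ]; that is, the minimum over {x ∈ [0,∞)^n : Σ x_i ≤ 1} of P[Σ x_i S_i ≤ t] is attained at the uniform vector (1/n, …, 1/n). -/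
open MeasureTheory ProbabilityTheory

lemma expInt (g : ℝ → ℝ) :
    ∫ s, g s ∂(expMeasure 1) = ∫ s in Set.Ioi (0:ℝ), Real.exp (-s) * g s := by
  have h : expMeasure 1 = volume.withDensity (exponentialPDF 1) := rfl
  rw [h, integral_withDensity_eq_integral_toReal_smul (by
    unfold exponentialPDF; fun_prop) (by
    filter_upwards with x; simp [exponentialPDF])]
  rw [← integral_Ici_eq_integral_Ioi, ← integral_indicator measurableSet_Ici]
  congr 1
  ext s
  rw [exponentialPDF_eq]
  by_cases hs : 0 ≤ s
  · simp [hs, Set.indicator, (Real.exp_pos _).le]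
  · simp [hs, Set.indicator]

instance : IsProbabilityMeasure (expMeasure 1) := isProbabilityMeasure_expMeasure one_pos

lemma exp_nonneg_ae : ∀ᵐ s ∂(expMeasure 1), 0 ≤ s := by
  have h : expMeasure 1 = volume.withDensity (exponentialPDF 1) := rfl
  rw [ae_iff, h]
  have : {a : ℝ | ¬ 0 ≤ a} = Set.Iio 0 := by ext; simp
  rw [this, withDensity_apply _ measurableSet_Iio]
  exact lintegral_exponentialPDF_of_nonpos le_rfl

lemma inner_change (b : ℝ) (hb : 0 < b) (c : ℝ) (ψ : ℝ → ℝ) :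
    ∫ r in Set.Ioi (0:ℝ), Real.exp (-r) * ψ (c + b * r)
      = ∫ z in Set.Ioi c, (1 / b) * Real.exp (-((z - c) / b)) * ψ z := by
  have h1 := integral_comp_mul_left_Ioi (fun r => (1/b) * Real.exp (-(r / b)) * ψ (c + r)) 0 hb
  have h2 : ∫ z in Set.Ioi c, (1 / b) * Real.exp (-((z - c) / b)) * ψ z
      = ∫ r in Set.Ioi (0:ℝ), (1/b) * Real.exp (-(r / b)) * ψ (c + r) := by
    rw [← integral_indicator measurableSet_Ioi, ← integral_indicator measurableSet_Ioi,
      ← integral_add_left_eq_self _ c]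
    congr 1
    ext r
    simp [Set.indicator]
  rw [h2]
  simp only [mul_zero, smul_eq_mul] at h1
  have h3 : ∫ r in Set.Ioi (0:ℝ), Real.exp (-r) * ψ (c + b * r)
      = b * ∫ x in Set.Ioi (0:ℝ), 1 / b * Real.exp (-(b * x / b)) * ψ (c + b * x) := by
    rw [← integral_const_mul]
    congr 1
    ext r
    field_simp
  rw [h3, h1]
  field_simp

lemma bdd_exp_integrable (ψ : ℝ → ℝ) (hm : Measurable ψ) (C : ℝ) (hC : ∀ t, |ψ t| ≤ C)
    (b : ℝ) (hb : 0 < b) (c : ℝ) :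
    IntegrableOn (fun z => (1 / b) * Real.exp (-((z - c) / b)) * ψ z) (Set.Ioi c) := by
  have h : IntegrableOn (fun z => (1 / b) * Real.exp (-((z - c) / b))) (Set.Ioi c) := by
    have := (integrableOn_exp_mul_Ioi (a := -(1/b)) (by simp [hb]) c).const_mul
      ((1/b) * Real.exp (c/b))
    refine IntegrableOn.congr_fun this (fun z _ => ?_) measurableSet_Ioi
    simp only [mul_assoc, ← Real.exp_add]
    ring_nf
  refine Integrable.mul_bdd (c := C) h hm.aestronglyMeasurable ?_
  filter_upwards with t using by simpa using hC t

lemma kernel_formula (ψ : ℝ → ℝ) (hm : Measurable ψ) (C : ℝ) (hC : ∀ t, |ψ t| ≤ C)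
    (a b : ℝ) (ha : 0 < a) (hb : 0 < b) :
    ∫ s in Set.Ioi (0:ℝ), Real.exp (-s) *
      (∫ r in Set.Ioi (0:ℝ), Real.exp (-r) * ψ (a * s + b * r))
    = ∫ z in Set.Ioi (0:ℝ), (∫ s in (0:ℝ)..(z/a), (1/b) * Real.exp (-s) * Real.exp (-((z - a*s)/b))) * ψ z := by
  simp only [inner_change b hb]
  set F : ℝ → ℝ → ℝ := fun s z => Set.indicator {p : ℝ × ℝ | 0 < p.1 ∧ a * p.1 < p.2}
    (fun p => Real.exp (-p.1) * ((1 / b) * Real.exp (-((p.2 - a * p.1) / b)) * ψ p.2)) (s, z) with hF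
  have hset : MeasurableSet {p : ℝ × ℝ | 0 < p.1 ∧ a * p.1 < p.2} :=
    MeasurableSet.inter (s₁ := {p : ℝ × ℝ | 0 < p.1}) (s₂ := {p : ℝ × ℝ | a * p.1 < p.2})
      (measurableSet_lt (by fun_prop) (by fun_prop)) (measurableSet_lt (by fun_prop) (by fun_prop))
  have hFm : Measurable (Function.uncurry F) := by
    apply Measurable.indicator _ hset
    fun_prop
  have hFs : ∀ s, F s = if 0 < s then Set.indicator (Set.Ioi (a * s)) (fun z => Real.exp (-s) * ((1 / b) * Real.exp (-((z - a * s) / b)) * ψ z)) else 0 := by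
    intro s
    ext z
    by_cases h : 0 < s <;> by_cases h' : a * s < z <;> simp [hF, Set.indicator, h, h']
  have hFint : Integrable (Function.uncurry F) (volume.prod volume) := by
    rw [integrable_prod_iff hFm.aestronglyMeasurable]
    constructor
    · filter_upwards with s
      simp only [Function.uncurry_apply_pair]
      change Integrable (F s) _
      rw [hFs]
      split_ifs
      · rw [integrable_indicator_iff measurableSet_Ioi]
        exact (bdd_exp_integrable ψ hm C hC b hb (a * s)).const_mul _
      · exact integrable_zero _ _ _
    · have hbound : Integrable (fun s => Set.indicator (Set.Ioi (0:ℝ)) (fun s => C * Real.exp (-s)) s) := by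
        rw [integrable_indicator_iff measurableSet_Ioi]
        have := integrableOn_exp_mul_Ioi (a := -1) (by simp) 0
        simp only [neg_mul, one_mul] at this
        exact this.const_mul C
      refine hbound.mono' ?_ ?_
      · exact (hFm.norm.stronglyMeasurable.integral_prod_right).aestronglyMeasurable
      · filter_upwards with s
        simp only [Function.uncurry_apply_pair]
        rw [Real.norm_of_nonneg (integral_nonneg (fun _ => norm_nonneg _))]
        by_cases hs : 0 < s
        · have e1 : ∀ z, ‖F s z‖ ≤ Set.indicator (Set.Ioi (a*s)) (fun z => C * Real.exp (-s) * ((1 / b) * Real.exp (-((z - a * s) / b)) * 1)) z := by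
            intro z
            rw [hFs, if_pos hs]
            by_cases h' : a * s < z
            · simp only [Set.indicator, Set.mem_Ioi, h', if_true, norm_mul, Real.norm_eq_abs, Real.abs_exp, abs_div, abs_one, abs_of_pos hb]
              have := hC z
              have h2 : 0 ≤ Real.exp (-s) * (1 / b * Real.exp (-((z - a * s) / b))) := by positivity
              nlinarith
            · simp [Set.indicator, h']
          have hI := (bdd_exp_integrable (fun _ => 1) (by fun_prop) 1 (by simp) b hb (a*s))
          have e2 := integral_mono_of_nonneg (μ := volume) (Filter.Eventually.of_forall (fun z => norm_nonneg (F s z))) (by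
              rw [integrable_indicator_iff measurableSet_Ioi]
              exact hI.const_mul _) (Filter.Eventually.of_forall e1)
          refine e2.trans ?_
          rw [integral_indicator measurableSet_Ioi, integral_const_mul, ← inner_change b hb (a*s) (fun _ => 1)]
          simp only [mul_one, integral_exp_neg_Ioi_zero]
          simp [Set.indicator, hs]
        · simp [hFs, hs, Set.indicator]
  have swap := integral_integral_swap hFint
  have L : ∫ s in Set.Ioi (0:ℝ), Real.exp (-s) * ∫ z in Set.Ioi (a*s), (1 / b) * Real.exp (-((z - a*s) / b)) * ψ z = ∫ s, ∫ z, F s z := by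
    rw [← integral_indicator measurableSet_Ioi]
    congr 1
    ext s
    change _ = ∫ z, (F s) z
    rw [hFs]
    by_cases hs : 0 < s
    · simp only [hs, if_true, Set.indicator, Set.mem_Ioi]
      rw [← integral_const_mul, ← integral_indicator measurableSet_Ioi]
      rfl
    · simp [hs, Set.indicator]
  rw [L, swap, ← integral_indicator measurableSet_Ioi]
  congr 1
  ext z
  by_cases hz : 0 < z
  · have hza : 0 ≤ z / a := by positivity
    simp only [Set.indicator, Set.mem_Ioi, hz, if_true]
    rw [intervalIntegral.integral_of_le hza, ← integral_mul_const, integral_Ioc_eq_integral_Ioo, ← integral_indicator measurableSet_Ioo]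
    congr 1
    ext s
    have : (0 < s ∧ a * s < z) ↔ s ∈ Set.Ioo 0 (z/a) := by
      rw [Set.mem_Ioo, lt_div_iff₀ ha, mul_comm]
    simp only [hF, Set.indicator, Set.mem_ofPred_eq, this]
    split_ifs
    · ring
    · rfl
  · have : ∀ s, F s z = 0 := by
      intro s
      simp only [hF, Set.indicator, Set.mem_ofPred_eq]
      rw [if_neg]
      rintro ⟨h1, h2⟩
      have := mul_pos ha h1
      linarith
    simp [this, hz, Set.indicator]

lemma exp_scale (a : ℝ) (ha : 0 < a) (ψ : ℝ → ℝ) :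
    a * ∫ r in Set.Ioi (0:ℝ), Real.exp (-r) * ψ (a * r)
      = ∫ z in Set.Ioi (0:ℝ), Real.exp (-(z / a)) * ψ z := by
  have h1 := integral_comp_mul_left_Ioi (fun r => Real.exp (-(r / a)) * ψ r) 0 ha
  simp only [mul_zero, smul_eq_mul] at h1
  have : ∀ x, a * x / a = x := fun x => by field_simp
  simp only [this] at h1
  rw [h1]; field_simp

lemma exp_integrable_scale (a : ℝ) (ha : 0 < a) (ψ : ℝ → ℝ) (hm : Measurable ψ) (C : ℝ) (hC : ∀ t, |ψ t| ≤ C) :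
    IntegrableOn (fun z => Real.exp (-(z / a)) * ψ z) (Set.Ioi (0:ℝ)) := by
  have := (bdd_exp_integrable ψ hm C hC a ha 0).const_mul a
  refine IntegrableOn.congr_fun this (fun z _ => ?_) measurableSet_Ioi
  simp
  field_simp

lemma resolvent_raw (ψ : ℝ → ℝ) (hm : Measurable ψ) (C : ℝ) (hC : ∀ t, |ψ t| ≤ C)
    (a b : ℝ) (ha : 0 < a) (hb : 0 < b) :
    (a - b) * ∫ s in Set.Ioi (0:ℝ), Real.exp (-s) *
      (∫ r in Set.Ioi (0:ℝ), Real.exp (-r) * ψ (a * s + b * r))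
    = a * (∫ s in Set.Ioi (0:ℝ), Real.exp (-s) * ψ (a * s))
      - b * (∫ s in Set.Ioi (0:ℝ), Real.exp (-s) * ψ (b * s)) := by
  rw [kernel_formula ψ hm C hC a b ha hb, exp_scale a ha, exp_scale b hb,
    ← integral_sub (exp_integrable_scale a ha ψ hm C hC) (exp_integrable_scale b hb ψ hm C hC),
    ← integral_const_mul]
  congr 1
  ext z
  rw [← mul_assoc, ← sub_mul]
  congr 1
  have hd : ∀ s ∈ Set.uIcc 0 (z/a), HasDerivAt (fun s => Real.exp (-s) * Real.exp (-((z - a*s)/b)))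
      ((a-b) * ((1/b) * Real.exp (-s) * Real.exp (-((z - a*s)/b)))) s := by
    intro s _
    have h1 : HasDerivAt (fun s : ℝ => Real.exp (-s)) (Real.exp (-s) * (-1)) s :=
      (hasDerivAt_id s).neg.exp
    have h2 : HasDerivAt (fun s : ℝ => Real.exp (-((z - a*s)/b))) (Real.exp (-((z - a*s)/b)) * (-((-(a * 1))/b))) s :=
      (((((hasDerivAt_id s).const_mul a).const_sub z).div_const b).neg).exp
    refine (h1.mul h2).congr_deriv ?_
    generalize Real.exp (-((z - a*s)/b)) = q
    field_simp
    ring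
  rw [← intervalIntegral.integral_const_mul, intervalIntegral.integral_eq_sub_of_hasDerivAt hd
    (Continuous.intervalIntegrable (by fun_prop) _ _)]
  have : a * (z / a) = z := by field_simp
  simp [this]

lemma gamma_raw (ψ : ℝ → ℝ) (hm : Measurable ψ) (C : ℝ) (hC : ∀ t, |ψ t| ≤ C)
    (a : ℝ) (ha : 0 < a) :
    ∫ s in Set.Ioi (0:ℝ), Real.exp (-s) *
      (∫ r in Set.Ioi (0:ℝ), Real.exp (-r) * ψ (a * s + a * r))
    = ∫ s in Set.Ioi (0:ℝ), Real.exp (-s) * (s * ψ (a * s)) := by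
  rw [kernel_formula ψ hm C hC a a ha ha]
  have h := exp_scale a ha (fun z => (z/a) * ψ z)
  have h2 : ∀ x, a * x / a = x := fun x => by field_simp
  simp only [h2] at h
  have h3 : ∫ s in Set.Ioi (0:ℝ), Real.exp (-s) * (s * ψ (a * s)) = (1/a) * (a * ∫ s in Set.Ioi (0:ℝ), Real.exp (-s) * (s * ψ (a * s))) := by
    rw [← mul_assoc, one_div_mul_cancel ha.ne', one_mul]
  rw [h3, h, ← integral_const_mul]
  congr 1
  ext z
  have : ∀ s, (1/a) * Real.exp (-s) * Real.exp (-((z - a*s)/a)) = (1/a) * Real.exp (-(z/a)) := by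
    intro s
    rw [mul_assoc, ← Real.exp_add]
    congr 2
    field_simp
    ring
  simp only [this]
  simp
  ring


/-- Bounded measurable functions on the line. -/
def BM : Submodule ℝ (ℝ → ℝ) where
  carrier := {f | Measurable f ∧ ∃ C, ∀ t, |f t| ≤ C}
  add_mem' := by
    rintro f g ⟨hf, C, hC⟩ ⟨hg, D, hD⟩
    exact ⟨hf.add hg, C + D, fun t => (abs_add_le _ _).trans (add_le_add (hC t) (hD t))⟩
  zero_mem' := ⟨measurable_const, 0, by simp⟩
  smul_mem' := by
    rintro c f ⟨hf, C, hC⟩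
    refine ⟨hf.const_smul c, |c| * C, fun t => ?_⟩
    simp only [Pi.smul_apply, smul_eq_mul, abs_mul]
    exact mul_le_mul_of_nonneg_left (hC t) (abs_nonneg _)

lemma BM_meas (f : BM) : Measurable f.1 := f.2.1

lemma BM_integrable {α : Type*} [MeasurableSpace α] (f : BM) (μ : Measure α) [IsFiniteMeasure μ]
    (u : α → ℝ) (hu : Measurable u) : Integrable (fun s => f.1 (u s)) μ := by
  obtain ⟨hf, C, hC⟩ := f.2
  refine Integrable.of_bound (hf.comp hu).aestronglyMeasurable C ?_
  filter_upwards with s using hC _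

/-- The averaging operator: expectation of `f (t - y S)`, with `S` exponential. -/
noncomputable def Eop (y : ℝ) : BM →ₗ[ℝ] BM where
  toFun f := ⟨fun t => ∫ s, f.1 (t - y * s) ∂(expMeasure 1), by
    refine ⟨?_, ?_⟩
    · have : Measurable (Function.uncurry fun t s : ℝ => f.1 (t - y * s)) :=
        (BM_meas f).comp (by fun_prop)
      exact this.stronglyMeasurable.integral_prod_right.measurable
    · obtain ⟨hf, C, hC⟩ := f.2
      refine ⟨C, fun t => ?_⟩
      have := norm_integral_le_of_norm_le_const (μ := expMeasure 1) (f := fun s => f.1 (t - y * s)) (C := C)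
        (Filter.Eventually.of_forall (fun s => hC _))
      simpa using this⟩
  map_add' f g := by
    ext t
    exact integral_add (BM_integrable f _ _ (by fun_prop)) (BM_integrable g _ _ (by fun_prop))
  map_smul' c f := by
    ext t
    exact integral_const_mul _ _

lemma Eop_apply (y : ℝ) (f : BM) (t : ℝ) :
    (Eop y f).1 t = ∫ s, f.1 (t - y * s) ∂(expMeasure 1) := rfl

lemma Eop_zero : Eop 0 = 1 := by
  ext f t
  simp [Eop_apply]

lemma Eop_comm (a b : ℝ) : Eop a * Eop b = Eop b * Eop a := by
  ext f t
  change (Eop a (Eop b f)).1 t = (Eop b (Eop a f)).1 t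
  simp only [Eop_apply]
  rw [integral_integral_swap]
  · congr 1; ext s; congr 1; ext r
    ring_nf
  · exact BM_integrable f ((expMeasure 1).prod (expMeasure 1)) (fun p => t - a * p.1 - b * p.2) (by fun_prop)

lemma Eop_resolvent (a b : ℝ) (ha : 0 ≤ a) (hb : 0 ≤ b) :
    a • Eop a - b • Eop b = (a - b) • (Eop a * Eop b) := by
  rcases ha.eq_or_lt with rfl | ha
  · rw [Eop_zero, one_mul]; module
  rcases hb.eq_or_lt with rfl | hb
  · rw [Eop_zero, mul_one]; module
  ext f t
  obtain ⟨hf, C, hC⟩ := f.2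
  have := resolvent_raw (fun z => f.1 (t - z)) (hf.comp (by fun_prop)) C (fun z => hC _) a b ha hb
  change a * (Eop a f).1 t - b * (Eop b f).1 t = (a - b) * (Eop a (Eop b f)).1 t
  simp only [Eop_apply, expInt]
  rw [← this]
  simp only [sub_sub]

lemma Eop_T (y : ℝ) (hy : 0 ≤ y) (f g : BM) (h : ∀ t, t * f.1 t = g.1 t) (t : ℝ) :
    t * (Eop y f).1 t = (Eop y (g + y • Eop y f)).1 t := by
  rw [map_add, map_smul]
  change _ = (Eop y g).1 t + y * (Eop y (Eop y f)).1 t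
  rcases hy.eq_or_lt with rfl | hy
  · simp [Eop_zero, h]
  obtain ⟨hf, C, hC⟩ := f.2
  have h1 := gamma_raw (fun z => f.1 (t - z)) (hf.comp (by fun_prop)) C (fun z => hC _) y hy
  simp only [← expInt] at h1
  simp only [← sub_sub] at h1
  rw [Eop_apply y (Eop y f)]
  simp only [Eop_apply]
  rw [h1, ← integral_const_mul, ← integral_const_mul, ← sub_eq_iff_eq_add,
    ← integral_sub]
  · congr 1
    ext s
    rw [← h]; ring
  · exact (BM_integrable f _ _ (by fun_prop)).const_mul _
  · have : (fun s => y * (s * f.1 (t - y * s))) = fun s => t * f.1 (t - y * s) - g.1 (t - y * s) := by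
      ext s; rw [← h]; ring
    rw [this]
    exact ((BM_integrable f _ _ (by fun_prop)).const_mul _).sub (BM_integrable g _ _ (by fun_prop))

lemma Eop_nonneg (y : ℝ) (hy : 0 ≤ y) (f : BM) (δ : ℝ) (h : ∀ t ≤ δ, 0 ≤ f.1 t) :
    ∀ t ≤ δ, 0 ≤ (Eop y f).1 t := by
  intro t ht
  apply integral_nonneg_of_ae
  filter_upwards [exp_nonneg_ae] with s hs
  exact h _ (by nlinarith [mul_nonneg hy hs])

lemma exp_Icc_pos (c : ℝ) (hc : 0 < c) : 0 < expMeasure 1 (Set.Iic c) := by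
  have h1 := cdf_expMeasure_eq (r := 1) one_pos c
  rw [cdf_eq_real, if_pos hc.le] at h1
  have h2 : 0 < (expMeasure 1).real (Set.Iic c) := by
    rw [h1]; simpa using hc
  rw [measureReal_def] at h2
  exact (ENNReal.toReal_pos_iff.1 h2).1

lemma Eop_pos (y : ℝ) (hy : 0 ≤ y) (f : BM) (h : ∀ t, 0 ≤ f.1 t) (h' : ∀ t > 0, 0 < f.1 t) :
    ∀ t > 0, 0 < (Eop y f).1 t := by
  intro t ht
  rw [Eop_apply, integral_pos_iff_support_of_nonneg (fun s => h _) (BM_integrable f _ _ (by fun_prop))]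
  refine (exp_Icc_pos (t / (y+1)) (by positivity)).trans_le (measure_mono ?_)
  intro s hs
  have hs' : s ≤ t / (y+1) := hs
  rw [le_div_iff₀ (by positivity)] at hs'
  refine (h' _ ?_).ne'
  by_cases h0 : 0 < s
  · nlinarith
  · nlinarith

lemma Eop_cont (y : ℝ) (hy : 0 < y) (f : BM) (h : ∀ t < 0, f.1 t = 0) :
    Continuous (Eop y f).1 := by
  have key : ∀ t, (Eop y f).1 t = (1/y) * Real.exp (-(t/y)) * ∫ z in (0:ℝ)..t, Real.exp (z/y) * f.1 z := by
    intro t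
    have e := exp_scale y hy (fun z => f.1 (t - z))
    rw [Eop_apply, expInt]
    have e2 : ∫ z in Set.Ioi (0:ℝ), Real.exp (-(z / y)) * f.1 (t - z)
        = Real.exp (-(t/y)) * ∫ z in (0:ℝ)..t, Real.exp (z/y) * f.1 z := by
      rw [← intervalIntegral.integral_const_mul]
      have e3 : ∫ z in Set.Ioi (0:ℝ), Real.exp (-(z / y)) * f.1 (t - z)
          = ∫ z in Set.Iio t, Real.exp (-(t / y)) * (Real.exp (z/y) * f.1 z) := by
        rw [← integral_indicator measurableSet_Ioi, ← integral_indicator measurableSet_Iio,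
          ← integral_sub_left_eq_self _ _ t]
        congr 1
        ext z
        simp only [Set.indicator, Set.mem_Ioi, Set.mem_Iio, sub_pos, sub_sub_cancel]
        split_ifs
        · rw [← mul_assoc, ← Real.exp_add]; ring_nf
        · rfl
      rw [e3]
      by_cases ht : 0 ≤ t
      · rw [intervalIntegral.integral_of_le ht, ← integral_Iic_eq_integral_Iio]
        refine setIntegral_eq_of_subset_of_ae_sdiff_eq_zero measurableSet_Iic.nullMeasurableSet
          (fun z hz => hz.2) ?_
        have : ∀ᵐ z : ℝ, z ≠ 0 := by simp [ae_iff]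
        filter_upwards [this] with z hz0 hz
        have : z < 0 := by
          by_contra hc
          exact hz.2 ⟨lt_of_le_of_ne (not_lt.1 hc) (Ne.symm hz0), hz.1⟩
        simp [h z this]
      · push Not at ht
        rw [setIntegral_eq_zero_of_forall_eq_zero (fun z hz => by
          simp [h z (lt_trans hz ht)])]
        symm
        rw [intervalIntegral.integral_of_ge ht.le, neg_eq_zero, integral_Ioc_eq_integral_Ioo]
        exact setIntegral_eq_zero_of_forall_eq_zero (fun z hz => by
          simp [h z hz.2])
    rw [e2] at e
    rw [mul_assoc, ← e, ← mul_assoc, one_div_mul_cancel hy.ne', one_mul]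
  rw [funext key]
  refine Continuous.mul (by fun_prop) ?_
  apply intervalIntegral.continuous_primitive
  intro a b
  obtain ⟨hf, C, hC⟩ := f.2
  have h1 : IntervalIntegrable f.1 volume a b := by
    refine IntervalIntegrable.mono_fun' (g := fun _ => C) (by simp) hf.aestronglyMeasurable ?_
    filter_upwards with s using hC s
  exact h1.continuousOn_mul (Continuous.continuousOn (by fun_prop))



/-- The ring generated by the averaging operators and the scalars. -/
noncomputable def EAS : Subring (Module.End ℝ BM) :=
  Subring.closure (Set.range Eop ∪ Set.range (fun c : ℝ => algebraMap ℝ (Module.End ℝ BM) c))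

lemma EAS_comm : IsMulCommutative EAS := by
  unfold EAS
  apply Subring.isMulCommutative_closure
  rintro _ (⟨a, rfl⟩ | ⟨a, rfl⟩) _ (⟨b, rfl⟩ | ⟨b, rfl⟩)
  · exact Eop_comm a b
  · exact (Algebra.commutes b (Eop a)).symm
  · exact Algebra.commutes a (Eop b)
  · exact Algebra.commutes a _

abbrev EA : Type := EAS

noncomputable instance : CommRing EA :=
  { (inferInstance : Ring EAS) with
    mul_comm := fun a b => EAS_comm.is_comm.comm a b }

noncomputable def e (y : ℝ) : EA := ⟨Eop y, Subring.subset_closure (Or.inl ⟨y, rfl⟩)⟩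

noncomputable def C (y : ℝ) : EA :=
  ⟨algebraMap ℝ (Module.End ℝ BM) y, Subring.subset_closure (Or.inr ⟨y, rfl⟩)⟩

noncomputable def act (p : EA) (f : BM) : BM := p.1 f

lemma act_mul (p q : EA) (f : BM) : act (p * q) f = act p (act q f) := rfl
lemma act_one (f : BM) : act 1 f = f := rfl
lemma act_add (p q : EA) (f : BM) : act (p + q) f = act p f + act q f := rfl
lemma act_sub (p q : EA) (f : BM) : act (p - q) f = act p f - act q f := rfl
lemma act_map_add (p : EA) (f g : BM) : act p (f + g) = act p f + act p g := map_add _ _ _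
lemma act_map_sub (p : EA) (f g : BM) : act p (f - g) = act p f - act p g := map_sub _ _ _
lemma act_map_smul (p : EA) (c : ℝ) (f : BM) : act p (c • f) = c • act p f := map_smul _ _ _
lemma act_C (c : ℝ) (f : BM) : act (C c) f = c • f := rfl
lemma act_e (y : ℝ) (f : BM) : act (e y) f = Eop y f := rfl
lemma C_add (a b : ℝ) : C (a + b) = C a + C b := Subtype.ext (map_add _ _ _)
lemma C_sub (a b : ℝ) : C (a - b) = C a - C b :=
  Subtype.ext (map_sub (algebraMap ℝ (Module.End ℝ BM)) a b)
lemma C_mul (a b : ℝ) : C (a * b) = C a * C b := Subtype.ext (map_mul _ _ _)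
lemma C_one : C 1 = 1 := Subtype.ext (map_one _)
lemma C_zero : C 0 = 0 := Subtype.ext (map_zero _)

lemma e_res (a b : ℝ) (ha : 0 ≤ a) (hb : 0 ≤ b) :
    C a * e a * (1 - e b) = C b * e b * (1 - e a) := by
  have h : C a * e a - C b * e b = (C a - C b) * (e a * e b) := by
    apply Subtype.ext
    have := Eop_resolvent a b ha hb
    rw [← C_sub]
    change algebraMap ℝ (Module.End ℝ BM) a * Eop a - algebraMap ℝ (Module.End ℝ BM) b * Eop b
      = algebraMap ℝ (Module.End ℝ BM) (a - b) * (Eop a * Eop b)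
    simpa only [Algebra.smul_def] using this
  linear_combination h

lemma exch {K : Type*} [CommRing K] (a b a' b' A B A' B' : K)
    (h1 : a*A*(1-A') = a'*A'*(1-A))
    (h2 : a*A*(1-B') = b'*B'*(1-A))
    (h3 : a'*A'*(1-B') = b'*B'*(1-A'))
    (h4 : a*A*(1-B) = b*B*(1-A))
    (h5 : a'*A'*(1-B) = b*B*(1-A'))
    (hs : a + b = a' + b') :
    a * a' * (A * B - A' * B') = (a' * b' - a * b) * (B * B' * (1 - A) * (1 - A')) := by
  linear_combination (a' * B * (1 - A')) * h2 + a * A * B * h3 - a' * A' * B' * h4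
    - a * B' * (1 - A) * h5 + (a' + b') * B * B' * h1 - a' * A' * (1 - A) * B * B' * hs

/-- Heaviside step. -/
noncomputable def θ : BM := ⟨fun t => if 0 ≤ t then 1 else 0, by
  refine ⟨Measurable.ite measurableSet_Ici measurable_const measurable_const, 1, fun t => ?_⟩
  dsimp only
  split_ifs <;> simp⟩

lemma θ_apply (t : ℝ) : θ.1 t = if 0 ≤ t then 1 else 0 := rfl

lemma eθ (y : ℝ) (hy : 0 < y) (t : ℝ) :
    (Eop y θ).1 t = if 0 ≤ t then 1 - Real.exp (-(t / y)) else 0 := by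
  rw [Eop_apply]
  have h1 : (fun s => θ.1 (t - y * s)) = Set.indicator (Set.Iic (t / y)) (fun _ => (1:ℝ)) := by
    ext s
    have : (0 ≤ t - y * s) ↔ s ≤ t / y := by
      rw [le_div_iff₀ hy, sub_nonneg, mul_comm]
    simp [θ_apply, Set.indicator, this]
  rw [h1, integral_indicator measurableSet_Iic]
  have h2 := cdf_expMeasure_eq (r := 1) one_pos (t / y)
  rw [cdf_eq_real] at h2
  have h3 : 0 ≤ t / y ↔ 0 ≤ t := by
    rw [le_div_iff₀ hy, zero_mul]
  simp only [h3, one_mul] at h2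
  simp [h2]

noncomputable def pp (a : ℝ) : BM := (1 / a) • (θ - Eop a θ)

lemma pp_apply (a : ℝ) (ha : 0 < a) (t : ℝ) :
    (pp a).1 t = if 0 ≤ t then (1 / a) * Real.exp (-(t / a)) else 0 := by
  change (1/a) * (θ.1 t - (Eop a θ).1 t) = _
  rw [eθ a ha, θ_apply]
  split_ifs
  · ring
  · simp

/-- `f` satisfies `t f(t) = (g f)(t)`. -/
def TT (g : EA) (f : BM) : Prop := ∀ t, t * f.1 t = (act g f).1 t

lemma TT_pp (a : ℝ) (ha : 0 < a) : TT (C a * e a) (pp a) := by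
  intro t
  change _ = a * (Eop a (pp a)).1 t
  rw [Eop_apply, expInt]
  simp only [pp_apply a ha]
  have h1 : (fun s => Real.exp (-s) * (if 0 ≤ t - a * s then (1 / a) * Real.exp (-((t - a * s) / a)) else 0))
      = Set.indicator (Set.Iic (t / a)) (fun _ => (1 / a) * Real.exp (-(t / a))) := by
    ext s
    have : (0 ≤ t - a * s) ↔ s ≤ t / a := by
      rw [le_div_iff₀ ha, sub_nonneg, mul_comm]
    simp only [Set.indicator, Set.mem_Iic, this]
    split_ifs
    · rw [mul_left_comm, ← Real.exp_add]
      congr 2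
      field_simp
      ring
    · simp
  rw [h1, setIntegral_indicator measurableSet_Iic, Set.Ioi_inter_Iic]
  rw [setIntegral_const]
  simp only [measureReal_def, Real.volume_Ioc, sub_zero, smul_eq_mul]
  split_ifs with h
  · rw [ENNReal.toReal_ofReal (by positivity)]
    field_simp
  · push Not at h
    rw [ENNReal.ofReal_of_nonpos (div_neg_of_neg_of_pos h ha).le]
    simp

lemma TT_e (g : EA) (f : BM) (y : ℝ) (hy : 0 ≤ y) (h : TT g f) :
    TT (C y * e y + g) (act (e y) f) := by
  intro t
  have := Eop_T y hy f (act g f) h t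
  rw [act_e, this, ← act_e, ← act_e, ← act_C]
  simp only [← act_mul, ← act_add]
  ring_nf

noncomputable def PR (R : Multiset ℝ) : EA := (R.map e).prod
noncomputable def SG (R : Multiset ℝ) : EA := (R.map (fun y => C y * e y)).sum

lemma TT_PR (R : Multiset ℝ) (hR : ∀ y ∈ R, 0 ≤ y) (g : EA) (f : BM) (h : TT g f) :
    TT (SG R + g) (act (PR R) f) := by
  induction R using Multiset.induction_on with
  | empty => simpa [SG, PR, act_one] using h
  | cons y R ih =>
    have := TT_e _ _ y (hR y (by simp)) (ih (fun z hz => hR z (by simp [hz])))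
    simpa [SG, PR, act_mul, add_assoc] using this

lemma PR_nonneg (R : Multiset ℝ) (hR : ∀ y ∈ R, 0 ≤ y) (f : BM) (δ : ℝ) (h : ∀ t ≤ δ, 0 ≤ f.1 t) :
    ∀ t ≤ δ, 0 ≤ (act (PR R) f).1 t := by
  induction R using Multiset.induction_on with
  | empty => simpa [PR, act_one] using h
  | cons y R ih =>
    have := Eop_nonneg y (hR y (by simp)) _ δ (ih (fun z hz => hR z (by simp [hz])))
    simpa [PR, act_mul, act_e] using this

lemma PR_pos (R : Multiset ℝ) (hR : ∀ y ∈ R, 0 ≤ y) (f : BM) (h : ∀ t, 0 ≤ f.1 t)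
    (h' : ∀ t > 0, 0 < f.1 t) :
    ∀ t > 0, 0 < (act (PR R) f).1 t := by
  induction R using Multiset.induction_on with
  | empty => simpa [PR, act_one] using h'
  | cons y R ih =>
    have hR' : ∀ z ∈ R, 0 ≤ z := fun z hz => hR z (by simp [hz])
    have := Eop_pos y (hR y (by simp)) _
      (fun t => PR_nonneg R hR' f t (fun s _ => h s) t le_rfl) (ih hR')
    simpa [PR, act_mul, act_e] using this

lemma PR_zero (R : Multiset ℝ) (hR : ∀ y ∈ R, 0 ≤ y) (f : BM) (h : ∀ t < 0, f.1 t = 0) :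
    ∀ t < 0, (act (PR R) f).1 t = 0 := by
  intro t ht
  apply le_antisymm
  · have := PR_nonneg R hR (-f) t (fun s hs => by
      change 0 ≤ - f.1 s
      rw [h s (by linarith)]; simp) t le_rfl
    have h2 : act (PR R) (-f) = - act (PR R) f := map_neg _ _
    rw [h2] at this
    change 0 ≤ - (act (PR R) f).1 t at this
    linarith
  · exact PR_nonneg R hR f t (fun s hs => by rw [h s (by linarith)]) t le_rfl

noncomputable def hh (a a' : ℝ) : BM := (1 / a') • (pp a - Eop a' (pp a))

lemma hh_nonneg (a a' : ℝ) (ha : 0 < a) (ha' : 0 < a') :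
    ∀ t ≤ 1 / (1 / a + 1 / a'), 0 ≤ (hh a a').1 t := by
  intro t ht
  change 0 ≤ (1/a') * ((pp a).1 t - (Eop a' (pp a)).1 t)
  refine mul_nonneg (by positivity) (sub_nonneg.2 ?_)
  have h1 : 0 ≤ (Eop a' ((1/a) • θ - pp a)).1 t := by
    refine Eop_nonneg a' ha'.le _ t (fun s _ => ?_) t le_rfl
    change 0 ≤ (1/a) * θ.1 s - (pp a).1 s
    rw [pp_apply a ha, θ_apply]
    split_ifs with h
    · have : Real.exp (-(s/a)) ≤ 1 := by
        rw [Real.exp_le_one_iff]; simp; positivity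
      have h2 : 0 < 1 / a := by positivity
      nlinarith
    · simp
  rw [map_sub, map_smul] at h1
  change 0 ≤ (1/a) * (Eop a' θ).1 t - (Eop a' (pp a)).1 t at h1
  rw [sub_nonneg] at h1
  refine h1.trans ?_
  rw [eθ a' ha', pp_apply a ha]
  split_ifs with h
  · refine mul_le_mul_of_nonneg_left ?_ (by positivity)
    have h2 := Real.add_one_le_exp (-(t/a))
    have h3 := Real.add_one_le_exp (-(t/a'))
    rw [le_div_iff₀ (by positivity)] at ht
    have : t * (1 / a + 1 / a') = t / a + t / a' := by ring
    linarith
  · simp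

lemma hh_zero (a a' : ℝ) (ha : 0 < a) (ha' : 0 < a') (t : ℝ) (ht : t < 0) :
    (hh a a').1 t = 0 := by
  change (1/a') * ((pp a).1 t - (act (e a') (pp a)).1 t) = 0
  have h1 : ∀ t < 0, (pp a).1 t = 0 := fun t ht => by
    rw [pp_apply a ha, if_neg (not_le.2 ht)]
  have := PR_zero {a'} (by simpa using ha'.le) (pp a) h1 t ht
  simp only [PR, Multiset.map_singleton, Multiset.prod_singleton] at this
  rw [this, h1 t ht]; simp


lemma SG_cons (y : ℝ) (Z : Multiset ℝ) : SG (y ::ₘ Z) = C y * e y + SG Z := by simp [SG]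
lemma PR_cons (y : ℝ) (Z : Multiset ℝ) : PR (y ::ₘ Z) = e y * PR Z := by simp [PR]

lemma SG_apply (Z : Multiset ℝ) (w : BM) (t : ℝ) :
    (act (SG Z) w).1 t = (Z.map fun y => y * (act (e y) w).1 t).sum := by
  induction Z using Multiset.induction_on with
  | empty => simp [SG]; rfl
  | cons y Z ih =>
    rw [SG_cons, Multiset.map_cons, Multiset.sum_cons, ← ih]
    rfl

lemma Id2 (Z : Multiset ℝ) (hZ : ∀ y ∈ Z, 0 ≤ y) (a' : ℝ) (ha' : 0 < a') (v0 : BM) (t : ℝ) :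
    Z.sum * (act (e a') v0).1 t - (act (SG Z) (act (e a') v0)).1 t
      = (Z.map fun y => y ^ 2 * (act (e y) (act (C (1 / a') * (1 - e a')) v0)).1 t).sum := by
  induction Z using Multiset.induction_on with
  | empty => simp [SG]; rfl
  | cons y Z ih =>
    rw [SG_cons, Multiset.map_cons, Multiset.sum_cons, Multiset.sum_cons,
      ← ih (fun z hz => hZ z (by simp [hz])), act_add]
    have hC : C (1 / a') * C a' = 1 := by
      rw [← C_mul, one_div_mul_cancel ha'.ne', C_one]
    have hr := e_res a' y ha'.le (hZ y (by simp))
    have key : C y * e a' - C y * e y * e a' = C (y ^ 2) * (e y * (C (1 / a') * (1 - e a'))) := by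
      rw [pow_two, C_mul]
      linear_combination C y * C (1 / a') * hr - C y * e a' * (1 - e y) * hC
    have k2 := congrArg (fun p => (act p v0).1 t) key
    have k3 : y * (act (e a') v0).1 t - (act (C y * e y) (act (e a') v0)).1 t
      = y ^ 2 * (act (e y) (act (C (1 / a') * (1 - e a')) v0)).1 t := k2
    rw [← k3]
    change (y + Z.sum) * (act (e a') v0).1 t - ((act (C y * e y) (act (e a') v0)).1 t + (act (SG Z) (act (e a') v0)).1 t) = _
    ring

lemma core (R : Multiset ℝ) (hR : ∀ y ∈ R, 0 ≤ y) (a a' c M : ℝ) (ha : 0 < a) (ha' : 0 < a')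
    (hc : 0 < c) (hM : ∀ y ∈ a ::ₘ a' ::ₘ c ::ₘ R, y ≤ M) (t : ℝ)
    (ht : t ≤ (a ::ₘ a' ::ₘ c ::ₘ R).sum - M) :
    0 ≤ (act (PR (c ::ₘ R)) (hh a a')).1 t := by
  set Y := a ::ₘ a' ::ₘ c ::ₘ R with hY
  set Q := c ::ₘ R with hQ
  have hQ0 : ∀ y ∈ Q, 0 ≤ y := by
    intro y hy
    rcases Multiset.mem_cons.1 hy with rfl | hy
    · exact hc.le
    · exact hR y hy
  have hY0 : ∀ y ∈ Y, 0 ≤ y := by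
    intro y hy
    rcases Multiset.mem_cons.1 hy with rfl | hy
    · exact ha.le
    rcases Multiset.mem_cons.1 hy with rfl | hy
    · exact ha'.le
    exact hQ0 y hy
  set v0 := act (PR Q) (pp a) with hv0
  set v := act (e a') v0 with hv
  set w := act (PR Q) (hh a a') with hw
  have hw2 : w = act (C (1 / a') * (1 - e a')) v0 := by
    have : hh a a' = act (C (1 / a') * (1 - e a')) (pp a) := rfl
    rw [hw, this, hv0, ← act_mul, ← act_mul, mul_comm]
  have hC : C (1 / a') * C a' = 1 := by
    rw [← C_mul, one_div_mul_cancel ha'.ne', C_one]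
  have hSGY : SG Y = C a * e a + (C a' * e a' + SG Q) := by
    rw [hY, SG_cons a, SG_cons a']
  have T0 : TT (SG Q + C a * e a) v0 := TT_PR Q hQ0 _ _ (TT_pp a ha)
  have T1 : TT (C a' * e a' + (SG Q + C a * e a)) v := TT_e _ _ a' ha'.le T0
  have Id1 : ∀ t, t * w.1 t + v.1 t = (act (SG Y) w).1 t := by
    intro t
    have e1 : w.1 t = (1/a') * (v0.1 t - v.1 t) := by rw [hw2]; rfl
    have e2 : C (1 / a') * ((SG Q + C a * e a) - (C a' * e a' + (SG Q + C a * e a)) * e a') + e a'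
        = SG Y * (C (1 / a') * (1 - e a')) := by
      rw [hSGY]
      linear_combination (- e a') * hC
    have e3 : (1/a') * ((act (SG Q + C a * e a) v0).1 t - (act (C a' * e a' + (SG Q + C a * e a)) v).1 t) + v.1 t
        = (act (SG Y) w).1 t := by
      rw [hw2]
      exact congrArg (fun p => (act p v0).1 t) e2
    rw [← e3, ← T0 t, ← T1 t, e1]
    ring
  have I2 : ∀ t, Y.sum * v.1 t - t * v.1 t = (Y.map fun y => y ^ 2 * (act (e y) w).1 t).sum := by
    intro t
    rw [hw2, ← Id2 Y hY0 a' ha' v0 t, T1 t]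
    have : C a' * e a' + (SG Q + C a * e a) = SG Y := by
      rw [hSGY]; ring
    rw [this]
  have vpos : ∀ t > 0, 0 < v.1 t := by
    have h0 : ∀ t, 0 ≤ (pp a).1 t := by
      intro t; rw [pp_apply a ha]; split_ifs <;> positivity
    have h1 : ∀ t > 0, 0 < (pp a).1 t := by
      intro t ht; rw [pp_apply a ha, if_pos (le_of_lt ht)]; positivity
    have : v = act (PR (a' ::ₘ Q)) (pp a) := by
      rw [PR_cons]; rfl
    rw [this]
    refine PR_pos _ ?_ _ h0 h1
    intro y hy
    exact hY0 y (by rw [hY]; exact Multiset.mem_cons_of_mem hy)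
  have wcont : Continuous w.1 := by
    have : w = Eop c (act (PR R) (hh a a')) := by
      rw [hw, hQ, PR_cons]; rfl
    rw [this]
    exact Eop_cont c hc _ (PR_zero R hR _ (hh_zero a a' ha ha'))
  set δ := 1 / (1 / a + 1 / a') with hδ
  have δpos : 0 < δ := by positivity
  have wδ : ∀ t ≤ δ, 0 ≤ w.1 t := PR_nonneg Q hQ0 _ δ (hh_nonneg a a' ha ha')
  have step : ∀ m, 0 < m → m < Y.sum - M → (∀ s ≤ m, 0 ≤ w.1 s) → 0 < w.1 m := by
    intro m hm hm2 hs
    have i1 := Id1 m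
    rw [SG_apply] at i1
    have i2 := I2 m
    have i3 : (Y.map fun y => y ^ 2 * (act (e y) w).1 m).sum
        ≤ (Y.map fun y => M * (y * (act (e y) w).1 m)).sum := by
      apply Multiset.sum_map_le_sum_map
      intro y hy
      have p1 := Eop_nonneg y (hY0 y hy) w m hs m le_rfl
      rw [← act_e] at p1
      have p2 : 0 ≤ y * (act (e y) w).1 m := mul_nonneg (hY0 y hy) p1
      nlinarith [hM y hy]
    rw [Multiset.sum_map_mul_left, ← i1, ← i2] at i3
    have hv := vpos m hm
    have hMpos : 0 < M := ha.trans_le (hM a (by rw [hY]; simp))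
    have : 0 < M * m * w.1 m := by nlinarith
    exact pos_of_mul_pos_right this (by positivity)
  by_contra hneg
  push Not at hneg
  set S := {s | w.1 s < 0} with hS
  have hSne : S.Nonempty := ⟨t, hneg⟩
  have hSb : BddBelow S := ⟨δ, fun s hs => by
    by_contra h
    exact absurd (wδ s (not_le.1 h).le) (not_le.2 hs)⟩
  set m := sInf S with hm
  have hδm : δ ≤ m := le_csInf hSne (fun s hs => by
    by_contra h
    exact absurd (wδ s (not_le.1 h).le) (not_le.2 hs))
  have hlt : ∀ s < m, 0 ≤ w.1 s := by
    intro s hs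
    by_contra h
    exact absurd (csInf_le hSb (show s ∈ S from not_le.1 h)) (not_le.2 hs)
  have hle : ∀ s ≤ m, 0 ≤ w.1 s := by
    intro s hs
    have hcl : IsClosed {s | 0 ≤ w.1 s} := isClosed_le continuous_const wcont
    have : Set.Iio m ⊆ {s | 0 ≤ w.1 s} := fun s hs => hlt s hs
    have h2 := hcl.closure_subset_iff.2 this
    rw [closure_Iio] at h2
    exact h2 hs
  have hmt : m < t := by
    rcases lt_or_ge m t with h | h
    · exact h
    · exact absurd (hle t h) (not_le.2 hneg)
  have hwm := step m (by linarith) (by linarith) hle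
  have hmem : m ∈ closure S := csInf_mem_closure hSne hSb
  have hcl : IsClosed {s | w.1 s ≤ 0} := isClosed_le wcont continuous_const
  have h3 : closure S ⊆ {s | w.1 s ≤ 0} := hcl.closure_subset_iff.2 (fun s hs => by
    have hs' : w.1 s < 0 := hs
    exact hs'.le)
  exact absurd (h3 hmem) (not_le.2 hwm)

lemma swap_step (R : Multiset ℝ) (hR : ∀ y ∈ R, 0 ≤ y) (a b u : ℝ) (hb : 0 ≤ b) (hbu : b < u)
    (hua : u < a) (hM : ∀ y ∈ R, y ≤ a) (t : ℝ) (ht : t ≤ (a ::ₘ b ::ₘ R).sum) :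
    (act (PR (u ::ₘ (a + b - u) ::ₘ R)) θ).1 t ≤ (act (PR (a ::ₘ b ::ₘ R)) θ).1 t := by
  have ha : 0 < a := by linarith
  have hu : 0 < u := by linarith
  have hc : 0 < a + b - u := by linarith
  have h := core (b ::ₘ R) (by
    intro y hy
    rcases Multiset.mem_cons.1 hy with rfl | hy
    · exact hb
    · exact hR y hy) a u (a + b - u) a ha hu hc (by
    intro y hy
    simp only [Multiset.mem_cons] at hy
    rcases hy with rfl | rfl | rfl | rfl | hy
    · exact le_rfl
    · exact hua.le
    · linarith
    · linarith
    · exact hM y hy) t (by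
    simp only [Multiset.sum_cons] at ht ⊢
    linarith)
  have ex := exch (C a) (C b) (C u) (C (a + b - u)) (e a) (e b) (e u) (e (a + b - u))
    (e_res a u ha.le hu.le) (e_res a _ ha.le hc.le) (e_res u _ hu.le hc.le)
    (e_res a b ha.le hb) (e_res u b hu.le hb) (by
      rw [← C_add, ← C_add]; congr 1; ring)
  have hCu : C (1 / u) * C u = 1 := by
    rw [← C_mul, one_div_mul_cancel hu.ne', C_one]
  have hCa : C (1 / a) * C a = 1 := by
    rw [← C_mul, one_div_mul_cancel ha.ne', C_one]
  have key : PR (a ::ₘ b ::ₘ R) - PR (u ::ₘ (a + b - u) ::ₘ R)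
      = C (u * (a + b - u) - a * b) * (PR ((a + b - u) ::ₘ b ::ₘ R) *
        (C (1 / u) * (1 - e u) * (C (1 / a) * (1 - e a)))) := by
    simp only [PR_cons]
    rw [C_sub, C_mul u, C_mul a]
    have : (C (1 / u) * C u) * (C (1 / a) * C a) = 1 := by rw [hCu, hCa, one_mul]
    linear_combination (PR R * C (1 / u) * C (1 / a)) * ex
      - (PR R * (e a * e b - e u * e (a + b - u))) * this
  have k2 := congrArg (fun p => (act p θ).1 t) key
  have k3 : (act (PR (a ::ₘ b ::ₘ R)) θ).1 t - (act (PR (u ::ₘ (a + b - u) ::ₘ R)) θ).1 t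
      = (u * (a + b - u) - a * b) * (act (PR ((a + b - u) ::ₘ b ::ₘ R)) (hh a u)).1 t := k2
  have : 0 ≤ u * (a + b - u) - a * b := by nlinarith
  have := mul_nonneg this h
  linarith

lemma smooth (u : ℝ) (t : ℝ) (N : ℕ) : ∀ X : Multiset ℝ, (∀ y ∈ X, 0 ≤ y) →
    X.sum = X.card * u → t ≤ X.sum → (X.filter (· ≠ u)).card ≤ N →
    (act (PR (Multiset.replicate X.card u)) θ).1 t ≤ (act (PR X) θ).1 t := by
  induction N with
  | zero =>
    intro X _ _ _ hN
    have h1 : X.filter (· ≠ u) = 0 := Multiset.card_eq_zero.1 (by omega)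
    rw [Multiset.filter_eq_nil] at h1
    have : X = Multiset.replicate X.card u := by
      rw [Multiset.eq_replicate_card]
      intro y hy
      simpa using h1 y hy
    rw [← this]
  | succ N ih =>
    intro X hX hs ht hN
    by_cases hall : ∀ y ∈ X, y = u
    · have : X = Multiset.replicate X.card u := Multiset.eq_replicate_card.2 hall
      rw [← this]
    have hsum0 : (X.map (fun y => y - u)).sum = 0 := by
      rw [Multiset.sum_map_sub]; simp [hs]
    have hup : ∃ y ∈ X, u < y := by
      by_contra hcon
      push Not at hcon hall
      obtain ⟨z, hz, hzu⟩ := hall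
      obtain ⟨X', rfl⟩ := Multiset.exists_cons_of_mem hz
      have h1 : (X'.map (fun y => y - u)).sum ≤ (X'.map (fun _ => (0:ℝ))).sum :=
        Multiset.sum_map_le_sum_map _ _ (fun y hy => by
          have := hcon y (Multiset.mem_cons_of_mem hy); linarith)
      have h2 := lt_of_le_of_ne (hcon z hz) hzu
      simp at h1 hsum0
      linarith
    have hdn : ∃ y ∈ X, y < u := by
      by_contra hcon
      push Not at hcon hall
      obtain ⟨z, hz, hzu⟩ := hall
      obtain ⟨X', rfl⟩ := Multiset.exists_cons_of_mem hz
      have h1 : (X'.map (fun _ => (0:ℝ))).sum ≤ (X'.map (fun y => y - u)).sum :=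
        Multiset.sum_map_le_sum_map _ _ (fun y hy => by
          have := hcon y (Multiset.mem_cons_of_mem hy); linarith)
      have h2 := lt_of_le_of_ne (hcon z hz) (Ne.symm hzu)
      simp at h1 hsum0
      linarith
    obtain ⟨y, hy, huy⟩ := hup
    obtain ⟨b, hb, hbu⟩ := hdn
    obtain ⟨a, haX, hamax⟩ := X.toFinset.exists_max_image id ⟨y, by simpa using hy⟩
    simp only [Multiset.mem_toFinset, id] at haX hamax
    have hua : u < a := huy.trans_le (hamax y hy)
    obtain ⟨X', rfl⟩ := Multiset.exists_cons_of_mem haX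
    have hbX : b ∈ X' := by
      rcases Multiset.mem_cons.1 hb with h | h
      · linarith
      · exact h
    obtain ⟨R, rfl⟩ := Multiset.exists_cons_of_mem hbX
    refine le_trans ?_ (swap_step R (fun y hy => hX y (by simp [hy])) a b u (hX b hb) hbu hua
      (fun y hy => hamax y (by simp [hy])) t ht)
    have := ih (u ::ₘ (a + b - u) ::ₘ R) ?_ ?_ ?_ ?_
    · simpa using this
    · intro y hy
      have hb0 := hX b hb
      simp only [Multiset.mem_cons] at hy
      rcases hy with rfl | rfl | hy
      · linarith
      · linarith
      · exact hX y (by simp [hy])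
    · simp at hs ⊢
      linarith
    · simp at ht ⊢
      linarith
    · rw [Multiset.filter_cons_of_pos _ (by exact hua.ne'), Multiset.filter_cons_of_pos _ (by exact hbu.ne)] at hN
      rw [Multiset.filter_cons_of_neg _ (by simp), Multiset.filter_cons]
      simp only [Multiset.card_cons, Multiset.card_add] at hN ⊢
      split_ifs <;> simp only [Multiset.card_singleton, Multiset.card_zero] <;> omega

lemma pi_formula (n : ℕ) : ∀ (x : Fin n → ℝ) (f : BM) (t : ℝ),
    (act (∏ i, e (x i)) f).1 t
      = ∫ s, f.1 (t - ∑ i, x i * s i) ∂(Measure.pi fun _ : Fin n => expMeasure 1) := by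
  induction n with
  | zero => intro x f t; simp [act_one]
  | succ n ih =>
    intro x f t
    rw [Fin.prod_univ_succ, act_mul, act_e, Eop_apply]
    have mp := measurePreserving_piFinSuccAbove (fun _ : Fin (n+1) => expMeasure 1) 0
    rw [← mp.symm.integral_comp (MeasurableEquiv.measurableEmbedding _), integral_prod]
    · congr 1
      ext s
      rw [ih]
      congr 1
      ext r
      simp [Fin.sum_univ_succ, MeasurableEquiv.piFinSuccAbove, Fin.insertNthEquiv]
      ring_nf
    · exact BM_integrable f _ _ (by fun_prop)

lemma pi_measure (n : ℕ) (x : Fin n → ℝ) (t : ℝ) :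
    (Measure.pi fun _ : Fin n => expMeasure 1) {s | ∑ i, x i * s i ≤ t}
      = ENNReal.ofReal ((act (∏ i, e (x i)) θ).1 t) := by
  have hm : MeasurableSet {s : Fin n → ℝ | ∑ i, x i * s i ≤ t} :=
    measurableSet_le (by fun_prop) (by fun_prop)
  have h1 : (fun s : Fin n → ℝ => θ.1 (t - ∑ i, x i * s i)) = Set.indicator {s | ∑ i, x i * s i ≤ t} 1 := by
    ext s
    simp [θ_apply, Set.indicator]
  rw [pi_formula, h1, integral_indicator_one hm, measureReal_def, ENNReal.ofReal_toReal (measure_ne_top _ _)]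

lemma prod_eq_PR (n : ℕ) (x : Fin n → ℝ) :
    ∏ i, e (x i) = PR (Finset.univ.val.map x) := by
  rw [PR, Multiset.map_map]; rfl

theorem uniform_minimizes_exp_tail
    (n : ℕ) (hn : 1 ≤ n) (t : ℝ) (ht : t ∈ Set.Ioc (0 : ℝ) 1)
    (x : Fin n → ℝ) (hx : ∀ i, 0 ≤ x i) (hsum : ∑ i, x i ≤ 1) :
    (Measure.pi fun _ : Fin n => expMeasure 1) {s | ∑ i, x i * s i ≤ t} ≥
      (Measure.pi fun _ : Fin n => expMeasure 1) {s | (1 / (n : ℝ)) * ∑ i, s i ≤ t} := by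
  have hn0 : (0:ℝ) < n := by exact_mod_cast hn
  set z : Fin n → ℝ := fun i => x i + (1 - ∑ i, x i) / n with hz
  have hd : 0 ≤ (1 - ∑ i, x i) / n := div_nonneg (by linarith) hn0.le
  have hz0 : ∀ i, 0 ≤ z i := fun i => add_nonneg (hx i) hd
  have hzs : ∑ i, z i = 1 := by
    simp only [hz, Finset.sum_add_distrib, Finset.sum_const, Finset.card_univ, Fintype.card_fin, nsmul_eq_mul]
    field_simp
    ring
  have m1 : (Measure.pi fun _ : Fin n => expMeasure 1) {s | ∑ i, z i * s i ≤ t} ≤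
      (Measure.pi fun _ : Fin n => expMeasure 1) {s | ∑ i, x i * s i ≤ t} := by
    apply measure_mono_ae
    have hae : ∀ᵐ s ∂(Measure.pi fun _ : Fin n => expMeasure 1), ∀ i, 0 ≤ s i := by
      rw [ae_all_iff]
      intro i
      exact (Measure.tendsto_eval_ae_ae (μ := fun _ : Fin n => expMeasure 1) (i := i)).eventually exp_nonneg_ae
    filter_upwards [hae] with s hs h
    refine le_trans (Finset.sum_le_sum fun i _ => ?_) h
    exact mul_le_mul_of_nonneg_right (by simp only [hz]; linarith) (hs i)
  refine ge_iff_le.2 (le_trans ?_ m1)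
  simp only [Finset.mul_sum]
  rw [pi_measure n (fun _ => 1 / (n:ℝ)), pi_measure n z]
  apply ENNReal.ofReal_le_ofReal
  have := smooth (1 / n) t n (Finset.univ.val.map z) (by
    intro y hy
    simp only [Multiset.mem_map] at hy
    obtain ⟨i, _, rfl⟩ := hy
    exact hz0 i) (by
    change ∑ i, z i = _
    rw [hzs]; simp [hn0.ne']) (by
    change t ≤ ∑ i, z i
    rw [hzs]; exact ht.2) (by
    refine (Multiset.card_le_card (Multiset.filter_le _ _)).trans ?_
    simp)
  rw [prod_eq_PR n z]
  refine le_trans (le_of_eq ?_) this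
  rw [prod_eq_PR]
  simp
end

section
/- Fix an integer m ≥ 1 and positive reals a₁, …, a_m, let μ = Σ_{i=1}^m a_i, let a_min = min_i a_i and a_max = max_i a_i, and let f = e_{a₁} ⋆ ⋯ ⋆ e_{a_m} be the iterated convolution of the exponential densities (the probability density of Σ_{i=1}^m a_i·S_i with S₁,…,S_m i.i.d. exponential of mean 1). Then f is differentiable at μ and f′(μ) ≤ −(a_min / a_max) · f(μ)/μ < 0, with equality in the first inequality if and only if a₁ = a₂ = ⋯ = a_m. In particular, the mode of the distribution of Σ a_i S_i is strictly smaller than its mean μ. -/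
open MeasureTheory

/-- The exponential density of mean `q`: `e_q(x) = q⁻¹ e^{-x/q}` for `x ≥ 0`, `0` otherwise. -/
noncomputable def expDensity (q : ℝ) (x : ℝ) : ℝ :=
  if 0 ≤ x then q⁻¹ * Real.exp (-x / q) else 0

/-- Convolution of two real functions (w.r.t. Lebesgue measure). -/
noncomputable def convFn (f g : ℝ → ℝ) (x : ℝ) : ℝ :=
  ∫ y, f (x - y) * g y

/-- Iterated convolution of exponential densities with means given by the list:
the density of `Σ aᵢ Sᵢ` with `Sᵢ` i.i.d. mean-1 exponentials. -/
noncomputable def expConvList : List ℝ → ℝ → ℝ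
  | [] => fun _ => 0
  | [a] => expDensity a
  | a :: b :: l => convFn (expDensity a) (expConvList (b :: l))

noncomputable def PP (a : ℝ) (g : ℝ → ℝ) (x : ℝ) : ℝ :=
  a⁻¹ * Real.exp (-x / a) * ∫ y in (0:ℝ)..x, Real.exp (y / a) * g y

noncomputable def QQ : List ℝ → ℝ → ℝ
  | [] => fun _ => 0
  | [a] => fun x => a⁻¹ * Real.exp (-x / a)
  | a :: b :: l => PP a (QQ (b :: l))

theorem PP_zero (a : ℝ) (g : ℝ → ℝ) : PP a g 0 = 0 := by simp [PP]

theorem exp_div_deriv (a x : ℝ) :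
    HasDerivAt (fun x => Real.exp (x / a)) (Real.exp (x / a) * (1 / a)) x :=
  ((hasDerivAt_id x).div_const a).exp

theorem exp_neg_div_deriv (a x : ℝ) :
    HasDerivAt (fun x => Real.exp (-x / a)) (Real.exp (-x / a) * (-1 / a)) x :=
  ((hasDerivAt_id x).neg.div_const a).exp

theorem PP_deriv {a : ℝ} (ha : 0 < a) {g : ℝ → ℝ} (hg : Continuous g) (x : ℝ) :
    HasDerivAt (PP a g) ((g x - PP a g x) / a) x := by
  have h1 : HasDerivAt (fun x => ∫ y in (0:ℝ)..x, Real.exp (y / a) * g y)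
      (Real.exp (x / a) * g x) x := by
    have hc : Continuous (fun y => Real.exp (y / a) * g y) := by fun_prop
    exact hc.integral_hasStrictDerivAt 0 x |>.hasDerivAt
  have h2 := ((exp_neg_div_deriv a x).const_mul a⁻¹).mul h1
  have he : Real.exp (-x / a) * Real.exp (x / a) = 1 := by
    rw [← Real.exp_add]; simp [neg_div]
  refine h2.congr_deriv ?_
  unfold PP
  linear_combination a⁻¹ * (g x) * he

theorem PP_cont {a : ℝ} (ha : 0 < a) {g : ℝ → ℝ} (hg : Continuous g) : Continuous (PP a g) :=
  continuous_iff_continuousAt.2 fun x => (PP_deriv ha hg x).continuousAt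

theorem PP_unique {a : ℝ} (ha : 0 < a) {g u : ℝ → ℝ} (hg : Continuous g)
    (hu : ∀ x, HasDerivAt u ((g x - u x) / a) x) (h0 : u 0 = 0) : u = PP a g := by
  have hd : ∀ x, HasDerivAt (fun x => Real.exp (x / a) * (u x - PP a g x)) 0 x := by
    intro x
    refine ((exp_div_deriv a x).mul ((hu x).sub (PP_deriv ha hg x))).congr_deriv ?_
    simp only [Pi.sub_apply]
    field_simp
    ring
  funext x
  have h := is_const_of_deriv_eq_zero (fun x => (hd x).differentiableAt) (fun x => (hd x).deriv) x 0
  simp only [h0, PP_zero, sub_zero, mul_zero] at h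
  have := (mul_eq_zero.1 h).resolve_left (Real.exp_pos _).ne'
  linarith

theorem PP_PP {a b : ℝ} (ha : 0 < a) (hb : 0 < b) (hab : a ≠ b) {g : ℝ → ℝ} (hg : Continuous g) :
    PP a (PP b g) = fun x => (b * PP b g x - a * PP a g x) / (b - a) := by
  symm
  have hne : b - a ≠ 0 := sub_ne_zero.2 hab.symm
  apply PP_unique ha (PP_cont hb hg)
  · intro x
    refine ((((PP_deriv hb hg x).const_mul b).sub
      ((PP_deriv ha hg x).const_mul a)).div_const (b - a)).congr_deriv ?_
    field_simp
    ring
  · simp [PP_zero]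

theorem PP_comm {a b : ℝ} (ha : 0 < a) (hb : 0 < b) {g : ℝ → ℝ} (hg : Continuous g) :
    PP a (PP b g) = PP b (PP a g) := by
  by_cases hab : a = b
  · rw [hab]
  · rw [PP_PP ha hb hab hg, PP_PP hb ha (Ne.symm hab) hg]
    funext x
    rw [← neg_sub b a, ← neg_sub (b * PP b g x), neg_div_neg_eq]

theorem QQ_cont : ∀ l : List ℝ, (∀ a ∈ l, 0 < a) → Continuous (QQ l)
  | [], _ => by simpa [QQ] using continuous_const
  | [a], _ => by simp only [QQ]; fun_prop
  | a :: b :: l, h => PP_cont (h a (by simp)) (QQ_cont (b :: l) fun c hc => h c (by simp [hc]))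

theorem QQ_pos : ∀ l : List ℝ, l ≠ [] → (∀ a ∈ l, 0 < a) → ∀ x, 0 < x → 0 < QQ l x
  | [], h, _, _, _ => absurd rfl h
  | [a], _, h, x, _ => by
    have : 0 < a := h a (by simp)
    simp only [QQ]; positivity
  | a :: b :: l, _, h, x, hx => by
    have ha : 0 < a := h a (by simp)
    have hl : ∀ c ∈ b :: l, 0 < c := fun c hc => h c (by simp [hc])
    have hc := QQ_cont _ hl
    have : 0 < ∫ y in (0:ℝ)..x, Real.exp (y / a) * QQ (b :: l) y := by
      apply intervalIntegral.intervalIntegral_pos_of_pos_on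
      · exact Continuous.intervalIntegrable (by fun_prop) _ _
      · intro y hy
        exact mul_pos (Real.exp_pos _) (QQ_pos (b :: l) (by simp) hl y hy.1)
      · exact hx
    simp only [QQ, PP]; positivity

theorem expConv_eq : ∀ l : List ℝ, (∀ a ∈ l, 0 < a) → ∀ x,
    expConvList l x = if 0 ≤ x then QQ l x else 0
  | [], _, x => by simp [expConvList, QQ]
  | [a], _, x => by simp [expConvList, QQ, expDensity]
  | a :: b :: l, h, x => by
    have hl : ∀ c ∈ b :: l, 0 < c := fun c hc => h c (by simp [hc])
    have ih := expConv_eq (b :: l) hl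
    simp only [expConvList, convFn]
    split_ifs with hx
    · have : (fun y => expDensity a (x - y) * expConvList (b :: l) y) =
        (Set.Icc 0 x).indicator
          (fun y => a⁻¹ * Real.exp (-x / a) * (Real.exp (y / a) * QQ (b :: l) y)) := by
        funext y
        rw [ih]
        unfold expDensity Set.indicator
        by_cases h1 : 0 ≤ y <;> by_cases h2 : y ≤ x <;> simp [h1, h2]
        have : -(x - y) / a = -x / a + y / a := by ring
        have h3 : (y - x) / a = -x / a + y / a := by ring
        simp only [h3, Real.exp_add]
        ring
      rw [this, integral_indicator measurableSet_Icc, integral_Icc_eq_integral_Ioc,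
        ← intervalIntegral.integral_of_le hx, intervalIntegral.integral_const_mul]
      rfl
    · have : (fun y => expDensity a (x - y) * expConvList (b :: l) y) = fun _ => 0 := by
        funext y
        rw [ih]
        unfold expDensity
        by_cases h1 : 0 ≤ y
        · have : ¬ (0 ≤ x - y) := by intro h; linarith
          simp only [this, if_false, zero_mul]
        · simp [h1]
      rw [this]; simp

theorem QQ_mul_id : ∀ l : List ℝ, (∀ a ∈ l, 0 < a) → ∀ x,
    x * QQ l x = (l.map fun c => c * PP c (QQ l) x).sum
  | [], _, x => by simp [QQ]
  | [a], h, x => by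
    have ha : 0 < a := h a (by simp)
    have : ∀ y : ℝ, Real.exp (y / a) * (a⁻¹ * Real.exp (-y / a)) = a⁻¹ := by
      intro y
      have : Real.exp (y / a) * Real.exp (-y / a) = 1 := by
        rw [← Real.exp_add]; simp [neg_div]
      linear_combination a⁻¹ * this
    simp [QQ, PP, this]
    field_simp
  | a :: b :: l, h, x => by
    have ha : 0 < a := h a (by simp)
    have hl : ∀ c ∈ b :: l, 0 < c := fun c hc => h c (by simp [hc])
    have ih := QQ_mul_id (b :: l) hl
    have hgc := QQ_cont _ hl
    rw [List.map_cons, List.sum_cons]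
    generalize hL : b :: l = L at *
    have hQ : QQ (a :: L) = PP a (QQ L) := by rw [← hL]; rfl
    have hfc : Continuous (PP a (QQ L)) := PP_cont ha hgc
    rw [hQ]
    -- sum of P_c P_a g
    have key : ∀ M : List ℝ, (∀ c ∈ M, 0 < c) → ∀ x,
        HasDerivAt (fun x => (M.map fun c => c * PP c (PP a (QQ L)) x).sum)
          (((M.map fun c => c * PP c (QQ L) x).sum
            - (M.map fun c => c * PP c (PP a (QQ L)) x).sum) / a) x := by
      intro M
      induction M with
      | nil => intro _ x; simpa using hasDerivAt_const x (0:ℝ)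
      | cons d M ihM =>
        intro hM x
        have hd : 0 < d := hM d (by simp)
        have h1 := ihM (fun c hc => hM c (by simp [hc])) x
        simp only [List.map_cons, List.sum_cons]
        have h2 := (PP_deriv ha (PP_cont hd hgc) x)
        rw [← PP_comm hd ha hgc] at h2
        refine ((h2.const_mul d).add h1).congr_deriv ?_
        field_simp
        ring
    have hz : ∀ M : List ℝ, (M.map fun c => c * PP c (PP a (QQ L)) 0).sum = 0 := by
      intro M; simp [PP_zero]
    have e1 : (fun x => x * PP a (QQ L) x) =
        PP a (fun x => a * PP a (QQ L) x + x * QQ L x) := by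
      apply PP_unique ha (by fun_prop)
      · intro x
        refine ((hasDerivAt_id x).mul (PP_deriv ha hgc x)).congr_deriv ?_
        simp only [id]
        field_simp
        ring
      · simp
    have e2 : (fun x => a * PP a (PP a (QQ L)) x +
        (L.map fun c => c * PP c (PP a (QQ L)) x).sum) =
        PP a (fun x => a * PP a (QQ L) x + x * QQ L x) := by
      apply PP_unique ha (by fun_prop)
      · intro x
        refine (((PP_deriv ha hfc x).const_mul a).add (key L hl x)).congr_deriv ?_
        rw [ih x]
        field_simp
        ring
      · simp [PP_zero]
    exact congrFun (e1.trans e2.symm) x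

def Uni (G : ℝ → ℝ) : Prop := ∃ G' : ℝ → ℝ, (∀ x, HasDerivAt G (G' x) x) ∧ 0 ≤ G 0 ∧
  ∀ y x, 0 ≤ y → y ≤ x → 0 ≤ G' x → 0 ≤ G' y

theorem ww_deriv {a : ℝ} (ha : 0 < a) {G G' : ℝ → ℝ} (hG : ∀ x, HasDerivAt G (G' x) x) (x : ℝ) :
    HasDerivAt (fun x => Real.exp (x / a) * (G x - PP a G x)) (Real.exp (x / a) * G' x) x := by
  have hc : Continuous G := continuous_iff_continuousAt.2 fun x => (hG x).continuousAt
  refine ((exp_div_deriv a x).mul ((hG x).sub (PP_deriv ha hc x))).congr_deriv ?_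
  simp only [Pi.sub_apply]
  field_simp
  ring

theorem PP_le {a : ℝ} (ha : 0 < a) {G G' : ℝ → ℝ} (hG : ∀ x, HasDerivAt G (G' x) x)
    (h0 : 0 ≤ G 0) {x : ℝ} (hx : 0 ≤ x) (hn : ∀ y, 0 ≤ y → y ≤ x → 0 ≤ G' y) :
    PP a G x ≤ G x := by
  have hm : MonotoneOn (fun x => Real.exp (x / a) * (G x - PP a G x)) (Set.Icc 0 x) := by
    apply monotoneOn_of_deriv_nonneg (convex_Icc 0 x)
    · exact fun y _ => (ww_deriv ha hG y).continuousAt.continuousWithinAt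
    · exact fun y _ => (ww_deriv ha hG y).differentiableAt.differentiableWithinAt
    · intro y hy
      rw [interior_Icc] at hy
      rw [(ww_deriv ha hG y).deriv]
      exact mul_nonneg (Real.exp_pos _).le (hn y hy.1.le hy.2.le)
  have h := hm (Set.left_mem_Icc.2 hx) (Set.right_mem_Icc.2 hx) hx
  simp only [PP_zero, zero_div, Real.exp_zero, one_mul, sub_zero] at h
  have := nonneg_of_mul_nonneg_right (h0.trans h) (Real.exp_pos _)
  linarith

theorem Uni.PP {a : ℝ} (ha : 0 < a) {G : ℝ → ℝ} (h : Uni G) : Uni (PP a G) := by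
  obtain ⟨G', hG, h0, hs⟩ := h
  have hc : Continuous G := continuous_iff_continuousAt.2 fun x => (hG x).continuousAt
  refine ⟨_, PP_deriv ha hc, (PP_zero a G).ge, ?_⟩
  intro y x hy hyx hx
  by_cases hGy : 0 ≤ G' y
  · have := PP_le ha hG h0 hy (fun z hz hzy => hs z y hz hzy hGy)
    exact div_nonneg (by linarith) ha.le
  · have hm : AntitoneOn (fun x => Real.exp (x / a) * (G x - _root_.PP a G x)) (Set.Icc y x) := by
      apply antitoneOn_of_deriv_nonpos (convex_Icc y x)
      · exact fun y _ => (ww_deriv ha hG y).continuousAt.continuousWithinAt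
      · exact fun y _ => (ww_deriv ha hG y).differentiableAt.differentiableWithinAt
      · intro z hz
        rw [interior_Icc] at hz
        rw [(ww_deriv ha hG z).deriv]
        have : G' z ≤ 0 := by
          by_contra hh
          exact hGy (hs y z hy hz.1.le (not_le.1 hh).le)
        exact mul_nonpos_of_nonneg_of_nonpos (Real.exp_pos _).le this
    have h := hm (Set.left_mem_Icc.2 hyx) (Set.right_mem_Icc.2 hyx) hyx
    have hx' : 0 ≤ G x - _root_.PP a G x := by
      have := mul_nonneg hx ha.le
      rwa [div_mul_cancel₀ _ ha.ne'] at this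
    have := nonneg_of_mul_nonneg_right ((mul_nonneg (Real.exp_pos (x / a)).le hx').trans h)
      (Real.exp_pos _)
    exact div_nonneg this ha.le

theorem QQ_uni : ∀ l : List ℝ, l ≠ [] → (∀ a ∈ l, 0 < a) → Uni (QQ l)
  | [], h, _ => absurd rfl h
  | [a], _, h => by
    have ha : 0 < a := h a (by simp)
    refine ⟨_, fun x => (exp_neg_div_deriv a x).const_mul a⁻¹, ?_, ?_⟩
    · simp only [QQ]; positivity
    · intro y x _ _ hx
      exfalso
      have : 0 < a⁻¹ * (Real.exp (-x / a) * (1 / a)) := by positivity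
      have e : a⁻¹ * (Real.exp (-x / a) * (-1 / a)) = -(a⁻¹ * (Real.exp (-x / a) * (1 / a))) := by
        ring
      rw [e] at hx
      linarith
  | a :: b :: l, _, h =>
    (QQ_uni (b :: l) (by simp) fun c hc => h c (by simp [hc])).PP (h a (by simp))

/-- Single crossing: if `f - P_a f ≥ 0` at `x` and `a < b` then `f - P_b f ≥ f - P_a f` at `x`. -/
theorem crossing {a b : ℝ} (ha : 0 < a) (hab : a < b) {f : ℝ → ℝ} (hf : Uni f) {x : ℝ}
    (hx : 0 ≤ x) (h : 0 ≤ f x - PP a f x) : f x - PP a f x ≤ f x - PP b f x := by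
  have hb := ha.trans hab
  obtain ⟨f', hf', h0, hs⟩ := hf
  have hc : Continuous f := continuous_iff_continuousAt.2 fun x => (hf' x).continuousAt
  obtain hu := (Uni.PP ha ⟨f', hf', h0, hs⟩)
  obtain ⟨H', hH, hH0, hHs⟩ := hu
  have e : H' x = (f x - PP a f x) / a := (hH x).unique (PP_deriv ha hc x)
  have hHx : 0 ≤ H' x := by rw [e]; exact div_nonneg h ha.le
  have h1 := PP_le hb hH hH0 hx (fun y hy hyx => hHs y x hy hyx hHx)
  rw [PP_PP hb ha hab.ne' hc] at h1
  have hne : 0 < b - a := sub_pos.2 hab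
  have h2 : (a * PP a f x - b * PP b f x) / (a - b) = (b * PP b f x - a * PP a f x) / (b - a) := by
    rw [← neg_sub b a, ← neg_sub (b * PP b f x), neg_div_neg_eq]
  simp only [h2] at h1
  rw [div_le_iff₀ hne] at h1
  have : 0 ≤ b * (PP a f x - PP b f x) := by nlinarith
  have := nonneg_of_mul_nonneg_right this hb
  linarith

theorem sum_le_aux {m : ℕ} (a d : Fin m → ℝ) (ha : ∀ i, 0 < a i) (hs : ∑ i, a i * d i = 0)
    (heq : ∀ i j, a i = a j → d i = d j)
    (hc : ∀ i j, a i < a j → 0 ≤ d i → d i ≤ d j) : ∑ i, d i ≤ 0 := by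
  by_cases hne : (Finset.univ.filter fun i => d i ≤ 0).Nonempty
  · obtain ⟨k, hk, hmax⟩ := Finset.exists_max_image _ a hne
    simp only [Finset.mem_filter, Finset.mem_univ, true_and] at hk hmax
    have h : ∀ i, 0 ≤ (a i - a k) * d i := by
      intro i
      rcases lt_trichotomy (a i) (a k) with h | h | h
      · have : d i ≤ 0 := by
          by_contra hh
          push Not at hh
          linarith [hc i k h hh.le]
        nlinarith
      · simp [h]
      · have : 0 < d i := by
          by_contra hh
          push Not at hh
          linarith [hmax i hh]
        nlinarith
    have h1 : 0 ≤ ∑ i, (a i - a k) * d i := Finset.sum_nonneg fun i _ => h i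
    simp only [sub_mul, Finset.sum_sub_distrib, hs, ← Finset.mul_sum] at h1
    have := ha k
    by_contra hh
    push Not at hh
    nlinarith
  · rw [Finset.not_nonempty_iff_eq_empty, Finset.filter_eq_empty_iff] at hne
    simp only [Finset.mem_univ, forall_const, not_le] at hne
    have h := (Finset.sum_eq_zero_iff_of_nonneg
      (fun i _ => (mul_pos (ha i) (hne (x := i))).le)).1 hs
    apply Finset.sum_nonpos
    intro i hi
    have := h i hi
    have := mul_pos (ha i) (hne (x := i))
    linarith

theorem deriv_at_mean_neg_of_exp_convolution
    (m : ℕ) (hm : 1 ≤ m) (a : Fin m → ℝ) (ha : ∀ i, 0 < a i)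
    (amin amax : ℝ)
    (hmin : IsLeast (Set.range a) amin) (hmax : IsGreatest (Set.range a) amax) :
    ∃ D : ℝ,
      HasDerivAt (expConvList (List.ofFn a)) D (∑ i, a i) ∧
      D ≤ -(amin / amax) * (expConvList (List.ofFn a) (∑ i, a i) / (∑ i, a i)) ∧
      -(amin / amax) * (expConvList (List.ofFn a) (∑ i, a i) / (∑ i, a i)) < 0 ∧
      (D = -(amin / amax) * (expConvList (List.ofFn a) (∑ i, a i) / (∑ i, a i)) ↔
        ∀ i j, a i = a j) := by
  have hl : ∀ c ∈ List.ofFn a, 0 < c := by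
    intro c hc
    obtain ⟨i, rfl⟩ := (List.mem_ofFn' a c).1 hc
    exact ha i
  have hne : List.ofFn a ≠ [] := by
    intro h
    have := congrArg List.length h
    simp at this
    omega
  have : NeZero m := ⟨by omega⟩
  have hμ : 0 < ∑ i, a i := Finset.sum_pos (fun i _ => ha i) Finset.univ_nonempty
  have hE := expConv_eq _ hl
  have hid := QQ_mul_id _ hl
  have hcont := QQ_cont _ hl
  have hpos := QQ_pos _ hne hl
  have huni := QQ_uni _ hne hl
  generalize expConvList (List.ofFn a) = F at *
  generalize QQ (List.ofFn a) = f at *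
  simp only [List.map_ofFn, List.sum_ofFn, Function.comp_apply] at hid
  generalize hM : ∑ i, a i = μ at *
  have hFμ : F μ = f μ := by rw [hE, if_pos hμ.le]
  have hfμ := hpos μ hμ
  set d : Fin m → ℝ := fun i => f μ - PP (a i) f μ with hd
  have hsum : ∑ i, a i * d i = 0 := by
    simp only [hd, mul_sub, Finset.sum_sub_distrib, ← Finset.sum_mul, hM, hid μ, sub_self]
  have hdle : ∑ i, d i ≤ 0 := by
    apply sum_le_aux a d ha hsum
    · intro i j h; simp only [hd, h]
    · intro i j h h'
      exact crossing (ha i) h huni hμ.le h'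
  obtain ⟨f', hf', -, -⟩ := id huni
  have hder : f μ + μ * f' μ = ∑ i, d i := by
    have h1 : HasDerivAt (fun x => x * f x) (1 * f μ + μ * f' μ) μ := (hasDerivAt_id μ).mul (hf' μ)
    have h2 : HasDerivAt (fun x => ∑ i, a i * PP (a i) f x) (∑ i, a i * (d i / a i)) μ :=
      HasDerivAt.fun_sum fun i _ => (PP_deriv (ha i) hcont μ).const_mul (a i)
    rw [funext hid] at h1
    have := h1.unique h2
    rw [one_mul] at this
    rw [this]
    exact Finset.sum_congr rfl fun i _ => mul_div_cancel₀ _ (ha i).ne'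
  have hD : f' μ = (∑ i, d i - f μ) / μ := by
    field_simp; linarith
  obtain ⟨i0, hi0⟩ := hmin.1
  obtain ⟨j0, hj0⟩ := hmax.1
  have hminpos : 0 < amin := hi0 ▸ ha i0
  have hmaxpos : 0 < amax := hj0 ▸ ha j0
  have hmm : amin ≤ amax := hmin.2 hmax.1
  have hr : amin / amax ≤ 1 := (div_le_one hmaxpos).2 hmm
  have hrpos : 0 < amin / amax := div_pos hminpos hmaxpos
  have hR : ∀ r : ℝ, -r * (f μ / μ) = (-r * f μ) / μ := fun r => by ring
  refine ⟨f' μ, ?_, ?_, ?_, ?_⟩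
  · refine (hf' μ).congr_of_eventuallyEq ?_
    filter_upwards [lt_mem_nhds hμ] with x hx
    rw [hE, if_pos hx.le]
  · rw [hFμ, hD, hR]
    apply div_le_div_of_nonneg_right _ hμ.le
    nlinarith
  · rw [hFμ, hR]
    apply div_neg_of_neg_of_pos _ hμ
    nlinarith [mul_pos hrpos hfμ]
  · rw [hFμ, hD, hR, div_left_inj' hμ.ne']
    constructor
    · intro h
      have h1 : 1 ≤ amin / amax := by
        by_contra hh
        push Not at hh
        nlinarith
      have h2 := (one_le_div hmaxpos).1 h1
      have h3 : ∀ i, a i = amin := fun i =>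
        le_antisymm ((hmax.2 ⟨i, rfl⟩).trans h2) (hmin.2 ⟨i, rfl⟩)
      intro i j
      rw [h3, h3]
    · intro h
      have h1 : amin = amax := by rw [← hi0, ← hj0]; exact h _ _
      have h2 : ∑ i, d i = 0 := by
        have : a i0 * ∑ i, d i = 0 := by
          rw [Finset.mul_sum, ← hsum]
          exact Finset.sum_congr rfl fun i _ => by rw [h i0 i]
        exact (mul_eq_zero.1 this).resolve_left (ha i0).ne'
      rw [h1, div_self hmaxpos.ne', h2]
      ring
end

section
/- Let S₁, S₂, … be i.i.d. random variables with the exponential distribution of mean 1, and let Z be a standard normal random variable independent of the S_i. Then for every a > 0 and b > 0: the infimum over all x = (x₁, x₂, …) ∈ [0,∞)^ℕ with Σ_{i=1}^{∞} x_i = 1 of P[ a·( Σ_{i=1}^{∞} x_i·S_i − 1 ) ≤ Z − b ] equals Q(b). -/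
open MeasureTheory ProbabilityTheory

/-- `μ` is the countable product of the probability measures `ν i`: it is a probability
measure giving every finite-dimensional cylinder set the product of the coordinate
probabilities. -/
def IsPiNat {Y : Type*} [MeasurableSpace Y] (ν : ℕ → Measure Y) (μ : Measure (ℕ → Y)) : Prop :=
  IsProbabilityMeasure μ ∧
    ∀ (s : Finset ℕ) (A : ℕ → Set Y), (∀ i, MeasurableSet (A i)) →
      μ {y | ∀ i ∈ s, y i ∈ A i} = ∏ i ∈ s, ν i (A i)


/-- The Gaussian Q-function `Q(y) = P[Z > y]` for `Z` standard normal. -/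
noncomputable def gaussianQ (y : ℝ) : ℝ :=
  (gaussianReal 0 1 (Set.Ioi y)).toReal


lemma aux_deriv_sign {ι : Type*} [Fintype ι] (c : ι → ℝ) (hc : ∀ i, 0 ≤ c i) (t : ℝ) (ht : 0 < t) :
    0 ≤ (t + ∑ i, c i ^ 2 * t / (1 + c i ^ 2 * t ^ 2)) * (∑ i, c i ^ 3 * t / (1 + c i ^ 2 * t ^ 2))
      + ∑ i, c i ^ 3 * (1 - c i ^ 2 * t ^ 2) / (1 + c i ^ 2 * t ^ 2) ^ 2 := by
  have hp : ∀ i, 0 < 1 + c i ^ 2 * t ^ 2 := fun i => by positivity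
  have h2 : ∀ i, 0 ≤ c i ^ 2 * t / (1 + c i ^ 2 * t ^ 2) := fun i => by positivity
  have h3 : ∀ i, 0 ≤ c i ^ 3 * t / (1 + c i ^ 2 * t ^ 2) := fun i => by
    have := hc i
    positivity
  have h4 : ∑ i, (c i ^ 2 * t / (1 + c i ^ 2 * t ^ 2)) * (c i ^ 3 * t / (1 + c i ^ 2 * t ^ 2))
      ≤ (t + ∑ i, c i ^ 2 * t / (1 + c i ^ 2 * t ^ 2)) *
        (∑ i, c i ^ 3 * t / (1 + c i ^ 2 * t ^ 2)) := by
    rw [Finset.mul_sum]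
    refine Finset.sum_le_sum fun i _ => mul_le_mul_of_nonneg_right ?_ (h3 i)
    have := Finset.single_le_sum (f := fun i => c i ^ 2 * t / (1 + c i ^ 2 * t ^ 2))
      (fun i _ => h2 i) (Finset.mem_univ i)
    linarith
  refine le_trans ?_ (add_le_add_left h4 _)
  rw [← Finset.sum_add_distrib]
  refine Finset.sum_nonneg fun i _ => ?_
  have : (c i ^ 2 * t / (1 + c i ^ 2 * t ^ 2)) * (c i ^ 3 * t / (1 + c i ^ 2 * t ^ 2))
     + c i ^ 3 * (1 - c i ^ 2 * t ^ 2) / (1 + c i ^ 2 * t ^ 2) ^ 2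
     = c i ^ 3 / (1 + c i ^ 2 * t ^ 2) ^ 2 := by
    have := (hp i).ne'
    field_simp
    ring
  rw [this]
  have := hc i
  positivity

/-- minus the phase -/
noncomputable def phA {ι : Type*} [Fintype ι] (c : ι → ℝ) (t : ℝ) : ℝ :=
  ∑ i, (c i * t - Real.arctan (c i * t))

noncomputable def phL {ι : Type*} [Fintype ι] (c : ι → ℝ) (t : ℝ) : ℝ :=
  ∑ i, (1/2) * Real.log (1 + c i ^ 2 * t ^ 2)

noncomputable def phD {ι : Type*} [Fintype ι] (c : ι → ℝ) (t : ℝ) : ℝ :=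
  ∑ i, c i ^ 3 * t / (1 + c i ^ 2 * t ^ 2)

lemma phA_deriv {ι : Type*} [Fintype ι] (c : ι → ℝ) (t : ℝ) :
    HasDerivAt (phA c) (t * phD c t) t := by
  unfold phA phD
  rw [Finset.mul_sum]
  refine HasDerivAt.fun_sum fun i _ => ?_
  have h1 : HasDerivAt (fun t => c i * t) (c i) t := by
    simpa using (hasDerivAt_id t).const_mul (c i)
  convert! h1.sub h1.arctan using 1
  have : 1 + c i ^ 2 * t ^ 2 ≠ 0 := by positivity
  have : 1 + (c i * t) ^ 2 ≠ 0 := by positivity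
  field_simp
  ring

lemma phL_deriv {ι : Type*} [Fintype ι] (c : ι → ℝ) (t : ℝ) :
    HasDerivAt (phL c) (∑ i, c i ^ 2 * t / (1 + c i ^ 2 * t ^ 2)) t := by
  unfold phL
  refine HasDerivAt.fun_sum fun i _ => ?_
  have h1 : HasDerivAt (fun t => 1 + c i ^ 2 * t ^ 2) (c i ^ 2 * (2 * t)) t := by
    simpa using ((hasDerivAt_pow 2 t).const_mul (c i ^ 2)).const_add 1
  have : 1 + c i ^ 2 * t ^ 2 ≠ 0 := by positivity
  convert! (h1.log this).const_mul (1/2) using 1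
  field_simp

lemma phD_deriv {ι : Type*} [Fintype ι] (c : ι → ℝ) (t : ℝ) :
    HasDerivAt (phD c) (∑ i, c i ^ 3 * (1 - c i ^ 2 * t ^ 2) / (1 + c i ^ 2 * t ^ 2) ^ 2) t := by
  unfold phD
  refine HasDerivAt.fun_sum fun i _ => ?_
  have h1 : HasDerivAt (fun t => 1 + c i ^ 2 * t ^ 2) (c i ^ 2 * (2 * t)) t := by
    simpa using ((hasDerivAt_pow 2 t).const_mul (c i ^ 2)).const_add 1
  have h2 : HasDerivAt (fun t => c i ^ 3 * t) (c i ^ 3) t := by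
    simpa using (hasDerivAt_id t).const_mul (c i ^ 3)
  have : 1 + c i ^ 2 * t ^ 2 ≠ 0 := by positivity
  convert! h2.div h1 this using 1
  congr 1
  ring

noncomputable def phG {ι : Type*} [Fintype ι] (c : ι → ℝ) (t : ℝ) : ℝ :=
  Real.exp (-(t ^ 2 / 2 + phL c t)) * (1 - Real.cos (phA c t)) / phD c t

lemma phD_pos {ι : Type*} [Fintype ι] (c : ι → ℝ) (hc : ∀ i, 0 ≤ c i) (j : ι) (hj : 0 < c j)
    (t : ℝ) (ht : 0 < t) : 0 < phD c t := by
  refine Finset.sum_pos' (fun i _ => ?_) ⟨j, Finset.mem_univ j, by positivity⟩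
  have := hc i
  positivity

lemma phG_deriv {ι : Type*} [Fintype ι] (c : ι → ℝ) (hc : ∀ i, 0 ≤ c i) (j : ι) (hj : 0 < c j)
    (t : ℝ) (ht : 0 < t) : ∃ g', HasDerivAt (phG c) g' t ∧
      g' ≤ t * Real.exp (-(t ^ 2 / 2 + phL c t)) * Real.sin (phA c t) := by
  have hD := phD_pos c hc j hj t ht
  have h1 : HasDerivAt (fun t => -(t ^ 2 / 2 + phL c t))
      (-(t + ∑ i, c i ^ 2 * t / (1 + c i ^ 2 * t ^ 2))) t := by
    have := ((hasDerivAt_pow 2 t).div_const 2).add (phL_deriv c t)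
    convert! this.neg using 1
    simp
  refine ⟨_, (h1.exp.mul ((phA_deriv c t).cos.const_sub 1)).div (phD_deriv c t) hD.ne', ?_⟩
  have hs := aux_deriv_sign c hc t ht
  change 0 ≤ (t + ∑ i, c i ^ 2 * t / (1 + c i ^ 2 * t ^ 2)) * phD c t + _ at hs
  set L' := t + ∑ i, c i ^ 2 * t / (1 + c i ^ 2 * t ^ 2)
  set D' := ∑ i, c i ^ 3 * (1 - c i ^ 2 * t ^ 2) / (1 + c i ^ 2 * t ^ 2) ^ 2
  simp only [Pi.mul_apply]
  set E := Real.exp (-(t ^ 2 / 2 + phL c t))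
  have hE : 0 < E := Real.exp_pos _
  rw [div_le_iff₀ (by positivity)]
  have h3 : 0 ≤ 1 - Real.cos (phA c t) := by linarith [Real.cos_le_one (phA c t)]
  have := mul_nonneg (mul_nonneg hE.le h3) hs
  nlinarith [this]

lemma phG_cont {ι : Type*} [Fintype ι] (c : ι → ℝ) (hc : ∀ i, 0 ≤ c i) (j : ι) (hj : 0 < c j) :
    ContinuousOn (phG c) (Set.Ici 0) := by
  intro t ht
  rcases (Set.mem_Ici.1 ht).eq_or_lt with rfl | ht
  · have h0 : phG c 0 = 0 := by simp [phG, phD]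
    rw [← continuousWithinAt_sdiff_self]
    have hset : Set.Ici (0:ℝ) \ {0} = Set.Ioi 0 := by simp
    rw [hset, ContinuousWithinAt, h0]
    set C := ∑ i, c i
    have hup : ∀ t ∈ Set.Ioi (0:ℝ), phG c t ≤ C ^ 2 / 2 * (t * (1 + c j ^ 2 * t ^ 2)) / c j ^ 3 := by
      intro t ht
      have ht : 0 < t := ht
      have hD : c j ^ 3 * t / (1 + c j ^ 2 * t ^ 2) ≤ phD c t :=
        Finset.single_le_sum (f := fun i => c i ^ 3 * t / (1 + c i ^ 2 * t ^ 2))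
          (fun i _ => by have := hc i; positivity) (Finset.mem_univ j)
      have hL : 0 ≤ phL c t := Finset.sum_nonneg fun i _ => by
        have := Real.log_nonneg (x := 1 + c i ^ 2 * t ^ 2) (by nlinarith [sq_nonneg (c i * t)])
        positivity
      have hE : Real.exp (-(t ^ 2 / 2 + phL c t)) ≤ 1 := by
        rw [Real.exp_le_one_iff]; nlinarith [sq_nonneg t]
      have hA1 : phA c t ≤ C * t := by
        rw [Finset.sum_mul]
        refine Finset.sum_le_sum fun i _ => ?_
        have := Real.arctan_nonneg.2 (mul_nonneg (hc i) ht.le)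
        linarith
      have hA0 : 0 ≤ phA c t := Finset.sum_nonneg fun i _ => by
        have := Real.le_tan (Real.arctan_nonneg.2 (mul_nonneg (hc i) ht.le))
          (Real.arctan_lt_pi_div_two _)
        rw [Real.tan_arctan] at this
        linarith
      have hcos := Real.one_sub_sq_div_two_le_cos (x := phA c t)
      have h1 : 1 - Real.cos (phA c t) ≤ (C * t) ^ 2 / 2 := by nlinarith
      have h3 : 0 ≤ 1 - Real.cos (phA c t) := by linarith [Real.cos_le_one (phA c t)]
      have : phG c t ≤ 1 * ((C * t) ^ 2 / 2) / (c j ^ 3 * t / (1 + c j ^ 2 * t ^ 2)) := by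
        unfold phG
        gcongr
      refine this.trans (le_of_eq ?_)
      field_simp
    have hlo : ∀ t ∈ Set.Ioi (0:ℝ), 0 ≤ phG c t := by
      intro t ht
      have h3 : 0 ≤ 1 - Real.cos (phA c t) := by linarith [Real.cos_le_one (phA c t)]
      have := phD_pos c hc j hj t ht
      unfold phG
      positivity
    have hlim : Filter.Tendsto (fun t : ℝ => C ^ 2 / 2 * (t * (1 + c j ^ 2 * t ^ 2)) / c j ^ 3)
        (nhdsWithin 0 (Set.Ioi 0)) (nhds 0) := by
      have : Continuous (fun t : ℝ => C ^ 2 / 2 * (t * (1 + c j ^ 2 * t ^ 2)) / c j ^ 3) := by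
        fun_prop
      have h := (this.tendsto 0).mono_left (nhdsWithin_le_nhds (s := Set.Ioi 0))
      simpa using h
    exact tendsto_of_tendsto_of_tendsto_of_le_of_le' tendsto_const_nhds hlim
      (Filter.eventually_of_mem self_mem_nhdsWithin hlo)
      (Filter.eventually_of_mem self_mem_nhdsWithin hup)
  · obtain ⟨g', h, _⟩ := phG_deriv c hc j hj t ht
    exact h.continuousAt.continuousWithinAt

lemma phA_cont {ι : Type*} [Fintype ι] (c : ι → ℝ) : Continuous (phA c) :=
  continuous_iff_continuousAt.2 fun t => (phA_deriv c t).continuousAt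
lemma phL_cont {ι : Type*} [Fintype ι] (c : ι → ℝ) : Continuous (phL c) :=
  continuous_iff_continuousAt.2 fun t => (phL_deriv c t).continuousAt

lemma phL_nonneg {ι : Type*} [Fintype ι] (c : ι → ℝ) (t : ℝ) : 0 ≤ phL c t :=
  Finset.sum_nonneg fun i _ => by
    have := Real.log_nonneg (x := 1 + c i ^ 2 * t ^ 2) (by nlinarith [sq_nonneg (c i * t)])
    positivity

lemma ph_integrable {ι : Type*} [Fintype ι] (c : ι → ℝ) :
    Integrable (fun t => t * Real.exp (-(t ^ 2 / 2 + phL c t)) * Real.sin (phA c t)) := by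
  have h : Integrable (fun t : ℝ => t * Real.exp (-(1/2) * t ^ 2)) :=
    integrable_mul_exp_neg_mul_sq (by norm_num)
  have := phA_cont c
  have := phL_cont c
  refine h.mono (by fun_prop) (Filter.Eventually.of_forall fun t => ?_)
  have hL := phL_nonneg c t
  simp only [norm_mul, Real.norm_eq_abs, Real.abs_exp]
  have h1 : Real.exp (-(t ^ 2 / 2 + phL c t)) ≤ Real.exp (-(1/2) * t ^ 2) := by
    apply Real.exp_le_exp.2; linarith
  have h2 := Real.abs_sin_le_one (phA c t)
  calc _ ≤ |t| * Real.exp (-(1/2) * t ^ 2) * 1 := by gcongr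
    _ = _ := by ring

lemma ph_integral_nonneg {ι : Type*} [Fintype ι] (c : ι → ℝ) (hc : ∀ i, 0 ≤ c i) :
    0 ≤ ∫ t in Set.Ioi 0, t * Real.exp (-(t ^ 2 / 2 + phL c t)) * Real.sin (phA c t) := by
  by_cases h : ∃ j, 0 < c j
  · obtain ⟨j, hj⟩ := h
    have hint := ph_integrable c
    refine ge_of_tendsto (intervalIntegral_tendsto_integral_Ioi 0 hint.integrableOn
      Filter.tendsto_id) ?_
    filter_upwards [Filter.eventually_gt_atTop 0] with R hR
    choose! g' hg' hle using phG_deriv c hc j hj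
    have := intervalIntegral.sub_le_integral_of_hasDeriv_right_of_le (g := phG c) hR.le
      ((phG_cont c hc j hj).mono Set.Icc_subset_Ici_self)
      (fun x hx => (hg' x hx.1).hasDerivWithinAt) hint.integrableOn (fun x hx => hle x hx.1)
    refine le_trans ?_ this
    have h0 : phG c 0 = 0 := by simp [phG, phD]
    rw [h0, sub_zero]
    have h3 : 0 ≤ 1 - Real.cos (phA c R) := by linarith [Real.cos_le_one (phA c R)]
    have := phD_pos c hc j hj R hR
    unfold phG
    positivity
  · push Not at h
    have hz : ∀ i, c i = 0 := fun i => le_antisymm (h i) (hc i)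
    simp [phA, hz]


lemma gauss_abs_integrable : Integrable (fun z : ℝ => z) (gaussianReal 0 1) := by
  have := memLp_id_gaussianReal (μ := 0) (v := 1) 1
  exact (memLp_one_iff_integrable.1 (by simpa [Function.id_def] using this))

lemma stein_cos (x : ℝ) : ∫ z, Real.cos (z * x) ∂(gaussianReal 0 1) = Real.exp (-(x ^ 2 / 2)) := by
  have h := charFun_gaussianReal (μ := 0) (v := 1) x
  rw [charFun_apply_real] at h
  have h2 := congrArg Complex.re h
  have hi : Integrable (fun z : ℝ => Complex.exp (x * z * Complex.I)) (gaussianReal 0 1) := by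
    refine Integrable.of_bound (by fun_prop) 1 (Filter.Eventually.of_forall fun z => ?_)
    rw [← Complex.ofReal_mul, Complex.norm_exp_ofReal_mul_I]
  have h3 := integral_re hi
  simp only [RCLike.re_to_complex] at h3
  rw [h2] at h3
  convert h3 using 1
  · refine integral_congr_ae (Filter.Eventually.of_forall fun z => ?_)
    simp only
    rw [← Complex.ofReal_mul, Complex.exp_ofReal_mul_I_re, mul_comm]
  · rw [← Complex.exp_ofReal_re]
    congr 2
    push_cast
    ring

lemma stein (x : ℝ) : ∫ z, z * Real.sin (z * x) ∂(gaussianReal 0 1) = x * Real.exp (-(x ^ 2 / 2)) := by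
  have h1 := (hasDerivAt_integral_of_dominated_loc_of_deriv_le (μ := gaussianReal 0 1)
    (F := fun x z => Real.cos (z * x)) (F' := fun x z => -(z * Real.sin (z * x))) (x₀ := x)
    (bound := fun z => |z|) Filter.univ_mem
    (Filter.Eventually.of_forall fun y => by fun_prop)
    (Integrable.of_bound (by fun_prop) 1 (Filter.Eventually.of_forall fun z => by
      simpa using Real.abs_cos_le_one _)) (by fun_prop)
    (Filter.Eventually.of_forall fun z y _ => by
      simp only [norm_neg, norm_mul, Real.norm_eq_abs]
      exact mul_le_of_le_one_right (abs_nonneg _) (Real.abs_sin_le_one _))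
    gauss_abs_integrable.abs
    (Filter.Eventually.of_forall fun z y _ => by
      have h : HasDerivAt (fun y => z * y) z y := by
        simpa using (hasDerivAt_id y).const_mul z
      convert! h.cos using 1
      ring)).2
  simp_rw [stein_cos] at h1
  have h2 : HasDerivAt (fun x : ℝ => Real.exp (-(x ^ 2 / 2))) (Real.exp (-(x ^ 2 / 2)) * -x) x := by
    have := ((hasDerivAt_pow 2 x).div_const 2).neg.exp
    convert! this using 1
    simp
  have := h1.unique h2
  rw [integral_neg] at this
  linarith

lemma expMeasure_eq : expMeasure 1 = (volume.restrict (Set.Ioi 0)).withDensity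
    (fun x => ENNReal.ofReal (Real.exp (-x))) := by
  rw [← withDensity_indicator measurableSet_Ioi]
  unfold expMeasure gammaMeasure
  apply withDensity_congr_ae
  have : ∀ᵐ x : ℝ, x ≠ 0 := by simp [ae_iff]
  filter_upwards [this] with x hx
  change exponentialPDF 1 x = _
  rw [exponentialPDF_eq]
  rcases lt_or_gt_of_ne hx with h | h
  · simp [h.not_ge, h.not_gt, Set.indicator]
  · simp [h, h.le, Set.indicator]

lemma expMeasure_integral {E : Type*} [NormedAddCommGroup E] [NormedSpace ℝ E] (f : ℝ → E) :
    ∫ x, f x ∂(expMeasure 1) = ∫ x in Set.Ioi 0, Real.exp (-x) • f x := by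
  rw [expMeasure_eq, integral_withDensity_eq_integral_toReal_smul (by fun_prop) (by simp)]
  simp [ENNReal.toReal_ofReal, (Real.exp_pos _).le]

lemma expMeasure_pos : ∀ᵐ x ∂(expMeasure 1), 0 ≤ x := by
  rw [expMeasure_eq]
  refine (withDensity_absolutelyContinuous _ _).ae_le ?_
  filter_upwards [ae_restrict_mem measurableSet_Ioi] with x hx using le_of_lt hx

lemma expMeasure_integrable : Integrable (fun x : ℝ => x) (expMeasure 1) := by
  rw [expMeasure_eq, integrable_withDensity_iff_integrable_smul' (by fun_prop) (by simp)]
  have := Real.GammaIntegral_convergent (s := 2) (by norm_num)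
  refine IntegrableOn.congr_fun this (fun x hx => ?_) measurableSet_Ioi
  have : (2:ℝ) - 1 = 1 := by norm_num
  simp [ENNReal.toReal_ofReal, (Real.exp_pos _).le, this]

lemma expMeasure_mean : ∫ x, x ∂(expMeasure 1) = 1 := by
  rw [expMeasure_integral]
  have := Real.Gamma_eq_integral (s := 2) (by norm_num)
  rw [Real.Gamma_two] at this
  rw [this]
  refine setIntegral_congr_fun measurableSet_Ioi (fun x hx => ?_)
  have : (2:ℝ) - 1 = 1 := by norm_num
  simp [this]

lemma polar (u : ℝ) : (1 - u * Complex.I)⁻¹ =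
    Complex.exp (-((1/2 * Real.log (1 + u ^ 2) : ℝ) : ℂ) + (Real.arctan u : ℂ) * Complex.I) := by
  have hp : 0 < 1 + u ^ 2 := by positivity
  have h1 : Real.exp (-(1/2 * Real.log (1 + u ^ 2))) = (√(1 + u ^ 2))⁻¹ := by
    rw [Real.exp_neg, mul_comm, ← Real.rpow_def_of_pos hp, Real.sqrt_eq_rpow]
  have hs : √(1 + u ^ 2) * √(1 + u ^ 2) = 1 + u ^ 2 := Real.mul_self_sqrt hp.le
  have hs0 : √(1 + u ^ 2) ≠ 0 := (Real.sqrt_pos.2 hp).ne'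
  rw [Complex.exp_add, Complex.exp_mul_I, ← Complex.ofReal_neg, ← Complex.ofReal_exp, h1,
    ← Complex.ofReal_cos, ← Complex.ofReal_sin, Real.cos_arctan, Real.sin_arctan]
  apply inv_eq_of_mul_eq_one_right
  have e1 : (√(1 + u ^ 2))⁻¹ * (√(1 + u ^ 2))⁻¹ = (1 + u ^ 2)⁻¹ := by rw [← mul_inv, hs]
  apply Complex.ext
  · simp
    field_simp
    rw [Real.sq_sqrt hp.le]
  · simp
    field_simp
    simp

lemma exp_charFun (c t : ℝ) : ∫ s, Complex.exp (((t * (c * (s - 1)) : ℝ) : ℂ) * Complex.I)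
      ∂(expMeasure 1) =
    Complex.exp (-((1/2 * Real.log (1 + c ^ 2 * t ^ 2) : ℝ) : ℂ)
      - ((c * t - Real.arctan (c * t) : ℝ) : ℂ) * Complex.I) := by
  rw [expMeasure_integral]
  have hre : (-(1 - (c * t : ℝ) * Complex.I)).re < 0 := by simp
  have h := integral_exp_mul_complex_Ioi hre 0
  have e : ∀ x : ℝ, Real.exp (-x) • Complex.exp (((t * (c * (x - 1)) : ℝ) : ℂ) * Complex.I)
     = Complex.exp (-((c * t : ℝ) * Complex.I)) * Complex.exp (-(1 - (c * t : ℝ) * Complex.I) * x) := by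
    intro x
    rw [Complex.real_smul, Complex.ofReal_exp, ← Complex.exp_add, ← Complex.exp_add]
    congr 1
    push_cast
    ring
  simp_rw [e]
  rw [integral_const_mul, h]
  have := polar (c * t)
  simp only [Complex.ofReal_zero, mul_zero, Complex.exp_zero, neg_div_neg_eq, one_div]
  rw [this, ← Complex.exp_add]
  congr 1
  push_cast
  rw [mul_pow]
  ring


section absOmega
variable {ι Ω : Type*} [Fintype ι] {mΩ : MeasurableSpace Ω} {μ : Measure Ω} {S : ι → Ω → ℝ}

lemma sin_expect [IsProbabilityMeasure μ] (hm : ∀ i, Measurable (S i)) (hI : iIndepFun S μ)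
    (hl : ∀ i, μ.map (S i) = expMeasure 1) (c : ι → ℝ) (t : ℝ) :
    ∫ ω, Real.sin (t * ∑ i, c i * (S i ω - 1)) ∂μ
      = -(Real.exp (-phL c t) * Real.sin (phA c t)) := by
  have h1 : ∫ ω, Complex.exp (((t * ∑ i, c i * (S i ω - 1) : ℝ) : ℂ) * Complex.I) ∂μ
      = Complex.exp (-((phL c t : ℝ) : ℂ) - ((phA c t : ℝ) : ℂ) * Complex.I) := by
    have h2 := hI.integral_fun_prod_comp (𝕜 := ℂ)
      (f := fun i s => Complex.exp (((t * (c i * (s - 1)) : ℝ) : ℂ) * Complex.I))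
      (fun i => (hm i).aemeasurable) (fun i => by fun_prop)
    have h3 : ∀ i, ∫ ω, Complex.exp (((t * (c i * (S i ω - 1)) : ℝ) : ℂ) * Complex.I) ∂μ =
        Complex.exp (-((1/2 * Real.log (1 + c i ^ 2 * t ^ 2) : ℝ) : ℂ)
      - ((c i * t - Real.arctan (c i * t) : ℝ) : ℂ) * Complex.I) := by
      intro i
      rw [← exp_charFun, ← hl i, integral_map (hm i).aemeasurable (by fun_prop)]
    simp_rw [h3, ← Complex.exp_sum] at h2
    convert h2 using 1
    · congr with ω
      congr 1
      rw [Finset.mul_sum]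
      push_cast
      rw [Finset.sum_mul]
    · congr 1
      unfold phL phA
      push_cast
      rw [Finset.sum_mul, ← Finset.sum_neg_distrib, ← Finset.sum_sub_distrib]
  have hi : Integrable
      (fun ω => Complex.exp (((t * ∑ i, c i * (S i ω - 1) : ℝ) : ℂ) * Complex.I)) μ := by
    refine Integrable.of_bound (by fun_prop) 1 (Filter.Eventually.of_forall fun z => ?_)
    rw [Complex.norm_exp_ofReal_mul_I]
  have h4 := integral_im hi
  simp only [RCLike.im_to_complex] at h4
  rw [h1] at h4
  simp only [Complex.exp_ofReal_mul_I_im] at h4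
  rw [h4, Complex.exp_im]
  simp

lemma gauss_neg [IsProbabilityMeasure μ] (hm : ∀ i, Measurable (S i)) (hI : iIndepFun S μ)
    (hl : ∀ i, μ.map (S i) = expMeasure 1) (c : ι → ℝ) (hc : ∀ i, 0 ≤ c i) :
    ∫ ω, (∑ i, c i * (S i ω - 1)) * Real.exp (-((∑ i, c i * (S i ω - 1)) ^ 2 / 2)) ∂μ ≤ 0 := by
  simp_rw [← stein]
  rw [integral_integral_swap]
  · simp_rw [integral_const_mul, sin_expect hm hI hl c]
    rw [integral_gaussianReal_eq_integral_smul one_ne_zero]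
    have e : ∀ z : ℝ, gaussianPDFReal 0 1 z • (z * -(Real.exp (-phL c z) * Real.sin (phA c z)))
        = (-(√(2 * Real.pi))⁻¹) *
        (fun t => t * Real.exp (-(t ^ 2 / 2 + phL c t)) * Real.sin (phA c t)) |z| := by
      intro z
      have he : (fun t => t * Real.exp (-(t ^ 2 / 2 + phL c t)) * Real.sin (phA c t)) |z| =
        (fun t => t * Real.exp (-(t ^ 2 / 2 + phL c t)) * Real.sin (phA c t)) z := by
        rcases abs_choice z with h | h
        · rw [h]
        · rw [h]
          have h1 : phL c (-z) = phL c z := by simp [phL]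
          have h2 : phA c (-z) = - phA c z := by
            simp only [phA, mul_neg, Real.arctan_neg]
            rw [← Finset.sum_neg_distrib]
            exact Finset.sum_congr rfl fun i _ => by ring
          simp [h1, h2]
      rw [he, gaussianPDFReal_def]
      simp only [smul_eq_mul]
      have : Real.exp (-(z ^ 2 / 2 + phL c z)) =
        Real.exp (-(z - 0) ^ 2 / (2 * ((1 : NNReal) : ℝ))) * Real.exp (-phL c z) := by
        rw [← Real.exp_add]; congr 1; simp; ring
      rw [this]
      simp
      ring
    simp_rw [e]
    rw [integral_const_mul, integral_comp_abs
      (f := fun t => t * Real.exp (-(t ^ 2 / 2 + phL c t)) * Real.sin (phA c t))]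
    have := ph_integral_nonneg c hc
    have h2 : 0 ≤ (√(2 * Real.pi))⁻¹ := by positivity
    nlinarith [mul_nonneg h2 this]
  · have h : Integrable (fun p : Ω × ℝ => p.2) (μ.prod (gaussianReal 0 1)) :=
      gauss_abs_integrable.comp_snd μ
    refine h.mono (by fun_prop) (Filter.Eventually.of_forall fun p => ?_)
    simp only [Function.uncurry, norm_mul, Real.norm_eq_abs]
    exact mul_le_of_le_one_right (abs_nonneg _) (Real.abs_sin_le_one _)

lemma gaussianQ_eq (y : ℝ) : gaussianQ y = ∫ x in Set.Ioi y, gaussianPDFReal 0 1 x := by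
  unfold gaussianQ
  rw [gaussianReal_apply_eq_integral _ one_ne_zero, ENNReal.toReal_ofReal]
  exact integral_nonneg fun x => gaussianPDFReal_nonneg _ _ _

lemma pdf_cont : Continuous (gaussianPDFReal 0 1) := by
  rw [gaussianPDFReal_def]; fun_prop

lemma gaussianQ_deriv (y : ℝ) : HasDerivAt gaussianQ (-gaussianPDFReal 0 1 y) y := by
  have hi := integrable_gaussianPDFReal 0 1
  have h1 : gaussianQ = fun y => gaussianQ 0 - ∫ x in (0:ℝ)..y, gaussianPDFReal 0 1 x := by
    funext y
    rw [gaussianQ_eq, gaussianQ_eq,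
      ← intervalIntegral.integral_Ioi_sub_Ioi' hi.integrableOn hi.integrableOn]
    ring
  rw [h1]
  exact (intervalIntegral.integral_hasDerivAt_right hi.intervalIntegrable
    (pdf_cont.stronglyMeasurableAtFilter _ _) pdf_cont.continuousAt).const_sub _

lemma gaussianQ_cont : Continuous gaussianQ :=
  continuous_iff_continuousAt.2 fun y => (gaussianQ_deriv y).continuousAt

lemma gaussianQ_bound (y : ℝ) : ‖gaussianQ y‖ ≤ 1 := by
  have : gaussianQ y = (gaussianReal 0 1).real (Set.Ioi y) := rfl
  rw [this, Real.norm_eq_abs, abs_of_nonneg measureReal_nonneg]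
  exact measureReal_le_one

lemma pdf_bound (y : ℝ) : |gaussianPDFReal 0 1 y| ≤ (√(2 * Real.pi))⁻¹ := by
  rw [abs_of_nonneg (gaussianPDFReal_nonneg _ _ _), gaussianPDFReal_def]
  simp only [NNReal.coe_one, mul_one]
  refine mul_le_of_le_one_right (by positivity) ?_
  rw [Real.exp_le_one_iff]
  have := sq_nonneg (y - 0)
  linarith

lemma finite_lower [IsProbabilityMeasure μ] (hm : ∀ i, Measurable (S i)) (hI : iIndepFun S μ)
    (hl : ∀ i, μ.map (S i) = expMeasure 1) (c : ι → ℝ) (hc : ∀ i, 0 ≤ c i) (b : ℝ) (hb : 0 < b) :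
    gaussianQ b ≤ ∫ ω, gaussianQ (b + ∑ i, c i * (S i ω - 1)) ∂μ := by
  set X : Ω → ℝ := fun ω => ∑ i, c i * (S i ω - 1) with hX
  have hXm : Measurable X := by fun_prop
  have hSi : ∀ i, Integrable (S i) μ := fun i => by
    have := expMeasure_integrable
    rw [← hl i] at this
    exact this.comp_measurable (hm i)
  have hXi : Integrable X μ :=
    integrable_finsetSum _ fun i _ => ((hSi i).sub (integrable_const 1)).const_mul _
  have hpc := pdf_cont
  have hqc := gaussianQ_cont
  have hd : ∀ u : ℝ, HasDerivAt (fun u => ∫ ω, gaussianQ (b + u * X ω) ∂μ)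
      (∫ ω, -(X ω * gaussianPDFReal 0 1 (b + u * X ω)) ∂μ) u := by
    intro u
    refine (hasDerivAt_integral_of_dominated_loc_of_deriv_le (μ := μ)
      (F := fun u ω => gaussianQ (b + u * X ω))
      (F' := fun u ω => -(X ω * gaussianPDFReal 0 1 (b + u * X ω))) (x₀ := u)
      (bound := fun ω => |X ω| * (√(2 * Real.pi))⁻¹) Filter.univ_mem
      (Filter.Eventually.of_forall fun y =>
        (hqc.measurable.comp (by fun_prop)).aestronglyMeasurable)
      (Integrable.of_bound (hqc.measurable.comp (by fun_prop)).aestronglyMeasurable 1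
        (Filter.Eventually.of_forall fun z => gaussianQ_bound _))
      (hXm.mul (hpc.measurable.comp (by fun_prop))).neg.aestronglyMeasurable
      (Filter.Eventually.of_forall fun z y _ => ?_)
      (hXi.abs.mul_const _)
      (Filter.Eventually.of_forall fun z y _ => ?_)).2
    · simp only [norm_neg, norm_mul, Real.norm_eq_abs]
      exact mul_le_mul_of_nonneg_left (pdf_bound _) (abs_nonneg _)
    · have h : HasDerivAt (fun y => b + y * X z) (X z) y := by
        simpa using ((hasDerivAt_id y).mul_const (X z)).const_add b
      convert! (gaussianQ_deriv (b + y * X z)).comp y h using 1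
      ring
  have hmono : MonotoneOn (fun u => ∫ ω, gaussianQ (b + u * X ω) ∂μ) (Set.Icc 0 1) := by
    refine monotoneOn_of_hasDerivWithinAt_nonneg (convex_Icc 0 1)
      (fun u _ => (hd u).continuousAt.continuousWithinAt)
      (fun u _ => (hd u).hasDerivWithinAt) ?_
    intro u hu
    rw [interior_Icc] at hu
    have hu0 : 0 < u := hu.1
    rw [integral_neg, neg_nonneg]
    have hg := gauss_neg hm hI hl (fun i => u * c i) (fun i => mul_nonneg hu0.le (hc i))
    have hsum : ∀ ω, ∑ i, u * c i * (S i ω - 1) = u * X ω := fun ω => by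
      rw [hX, Finset.mul_sum]
      exact Finset.sum_congr rfl fun i _ => by ring
    simp_rw [hsum] at hg
    set K := (√(2 * Real.pi))⁻¹ * Real.exp (-(b ^ 2 / 2)) with hK
    have hK0 : 0 ≤ K := by positivity
    have hle : ∀ ω, X ω * gaussianPDFReal 0 1 (b + u * X ω) ≤
        K / u * (u * X ω * Real.exp (-((u * X ω) ^ 2 / 2))) := by
      intro ω
      have e1 : gaussianPDFReal 0 1 (b + u * X ω) =
          K * Real.exp (-(b * u * X ω)) * Real.exp (-((u * X ω) ^ 2 / 2)) := by
        rw [gaussianPDFReal_def, hK]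
        simp only [NNReal.coe_one, mul_one]
        rw [mul_assoc _ (Real.exp _) (Real.exp _), mul_assoc, ← Real.exp_add, ← Real.exp_add]
        congr 2
        ring
      have e2 : X ω * Real.exp (-(b * u * X ω)) ≤ X ω := by
        rcases le_total 0 (X ω) with h | h
        · refine mul_le_of_le_one_right h ?_
          rw [Real.exp_le_one_iff]
          have : 0 ≤ b * u * X ω := by positivity
          linarith
        · have : 1 ≤ Real.exp (-(b * u * X ω)) := by
            rw [Real.one_le_exp_iff]
            have := mul_nonneg (mul_pos hb hu0).le (neg_nonneg.2 h)
            linarith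
          nlinarith
      rw [e1]
      calc _ = (X ω * Real.exp (-(b * u * X ω))) * (K * Real.exp (-((u * X ω) ^ 2 / 2))) := by ring
        _ ≤ X ω * (K * Real.exp (-((u * X ω) ^ 2 / 2))) :=
            mul_le_mul_of_nonneg_right e2 (by positivity)
        _ = _ := by field_simp
    have hi1 : Integrable (fun ω => X ω * gaussianPDFReal 0 1 (b + u * X ω)) μ := by
      refine (hXi.abs.mul_const (√(2 * Real.pi))⁻¹).mono'
        (hXm.mul (hpc.measurable.comp (by fun_prop))).aestronglyMeasurable
        (Filter.Eventually.of_forall fun z => ?_)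
      simp only [norm_mul, Real.norm_eq_abs]
      exact mul_le_mul_of_nonneg_left (pdf_bound _) (abs_nonneg _)
    have hi2 : Integrable (fun ω => K / u * (u * X ω * Real.exp (-((u * X ω) ^ 2 / 2)))) μ := by
      refine Integrable.const_mul ?_ _
      refine (hXi.const_mul u).mono (by fun_prop) (Filter.Eventually.of_forall fun z => ?_)
      simp only [norm_mul, Real.norm_eq_abs, Real.abs_exp]
      refine mul_le_of_le_one_right (by positivity) ?_
      rw [Real.exp_le_one_iff]
      have := sq_nonneg (u * X z)
      linarith
    refine (integral_mono hi1 hi2 hle).trans ?_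
    rw [integral_const_mul]
    exact mul_nonpos_of_nonneg_of_nonpos (by positivity) hg
  have := hmono (Set.left_mem_Icc.2 zero_le_one) (Set.right_mem_Icc.2 zero_le_one) zero_le_one
  simpa using this

end absOmega

section final
variable {ν : Measure (ℕ → ℝ)}

lemma pi_eq_inf (hν : IsPiNat (fun _ => expMeasure 1) ν) :
    iIndepFun (fun i (ω : ℕ → ℝ) => ω i) ν ∧
      ∀ i, ν.map (fun ω : ℕ → ℝ => ω i) = expMeasure 1 := by
  have := isProbabilityMeasure_expMeasure (r := 1) one_pos
  have h : ν = Measure.infinitePi (fun _ : ℕ => expMeasure 1) := by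
    refine Measure.eq_infinitePi _ fun s t ht => ?_
    exact hν.2 s t ht
  rw [h]
  exact ⟨iIndepFun_infinitePi (X := fun _ x => x) (fun i => measurable_id),
    fun i => Measure.infinitePi_map_eval _ i⟩

lemma prob_eq [IsProbabilityMeasure ν] (T : (ℕ → ℝ) → ℝ) (hT : AEMeasurable T ν) (a b : ℝ) :
    ((ν.prod (gaussianReal 0 1)) {p | a * (T p.1 - 1) ≤ p.2 - b}).toReal
      = ∫ ω, gaussianQ (b + a * (T ω - 1)) ∂ν := by
  obtain ⟨T', hm, he⟩ := hT
  have h1 : {p : (ℕ → ℝ) × ℝ | a * (T p.1 - 1) ≤ p.2 - b} =ᵐ[ν.prod (gaussianReal 0 1)]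
      {p | a * (T' p.1 - 1) ≤ p.2 - b} := by
    have := Measure.quasiMeasurePreserving_fst (μ := ν) (ν := gaussianReal 0 1) |>.ae he
    filter_upwards [this] with p hp
    have hp : T p.1 = T' p.1 := hp
    change (a * (T p.1 - 1) ≤ p.2 - b) = (a * (T' p.1 - 1) ≤ p.2 - b)
    rw [hp]
  have hms : MeasurableSet {p : (ℕ → ℝ) × ℝ | a * (T' p.1 - 1) ≤ p.2 - b} :=
    measurableSet_le (by fun_prop) (by fun_prop)
  rw [measure_congr h1, Measure.prod_apply hms, ← integral_toReal
    (measurable_measure_prodMk_left hms).aemeasurable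
    (Filter.Eventually.of_forall fun ω => measure_lt_top _ _)]
  refine integral_congr_ae ?_
  filter_upwards [he] with ω hω
  rw [hω]
  have : Prod.mk ω ⁻¹' {p : (ℕ → ℝ) × ℝ | a * (T' p.1 - 1) ≤ p.2 - b}
      = Set.Ici (b + a * (T' ω - 1)) := by
    ext z
    simp only [Set.mem_preimage, Set.mem_ofPred_eq, Set.mem_Ici]
    constructor <;> intro h <;> linarith
  rw [this]
  unfold gaussianQ
  have : NullSingletonClass (gaussianReal 0 1) := nullSingletonClass_gaussianReal one_ne_zero
  rw [measure_congr Ioi_ae_eq_Ici]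

lemma ae_summable (hν : IsPiNat (fun _ => expMeasure 1) ν) (x : ℕ → ℝ) (hx : ∀ i, 0 ≤ x i)
    (hs : Summable x) : ∀ᵐ ω ∂ν, Summable (fun i => x i * ω i) := by
  obtain ⟨_, hl⟩ := pi_eq_inf hν
  have hpos : ∀ᵐ ω ∂ν, ∀ i, 0 ≤ ω i := by
    rw [ae_all_iff]
    intro i
    have := expMeasure_pos
    rw [← hl i] at this
    exact ae_of_ae_map (measurable_pi_apply i).aemeasurable this
  have hE : ∀ i, ∫⁻ ω, ENNReal.ofReal (x i * ω i) ∂ν = ENNReal.ofReal (x i) := by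
    intro i
    have h1 : ∫⁻ s, ENNReal.ofReal s ∂(expMeasure 1) = 1 := by
      rw [← ofReal_integral_eq_lintegral_ofReal expMeasure_integrable expMeasure_pos,
        expMeasure_mean, ENNReal.ofReal_one]
    simp_rw [ENNReal.ofReal_mul (hx i)]
    rw [lintegral_const_mul _ (by fun_prop),
      ← lintegral_map (f := fun s => ENNReal.ofReal s) (by fun_prop) (measurable_pi_apply i), hl i,
      h1, mul_one]
  have hfin : ∫⁻ ω, ∑' i, ENNReal.ofReal (x i * ω i) ∂ν ≠ ⊤ := by
    rw [lintegral_tsum (fun i => Measurable.aemeasurable (by fun_prop))]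
    simp_rw [hE]
    rw [← ENNReal.ofReal_tsum_of_nonneg hx hs]
    exact ENNReal.ofReal_ne_top
  have := ae_lt_top (by fun_prop) hfin
  filter_upwards [this, hpos] with ω h1 h2
  have h3 := ENNReal.summable_toReal h1.ne
  refine h3.congr fun i => ?_
  rw [ENNReal.toReal_ofReal (mul_nonneg (hx i) (h2 i))]

lemma final_lower (hν : IsPiNat (fun _ => expMeasure 1) ν) (a b : ℝ) (ha : 0 < a) (hb : 0 < b)
    (x : ℕ → ℝ) (hx : ∀ i, 0 ≤ x i) (hs : Summable x) (h1 : ∑' i, x i = 1) :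
    AEMeasurable (fun ω : ℕ → ℝ => ∑' i, x i * ω i) ν ∧
    gaussianQ b ≤ ∫ ω, gaussianQ (b + a * ((∑' i, x i * ω i) - 1)) ∂ν := by
  have := hν.1
  obtain ⟨hI, hl⟩ := pi_eq_inf hν
  have hsum := ae_summable hν x hx hs
  have hm : AEMeasurable (fun ω : ℕ → ℝ => ∑' i, x i * ω i) ν := by
    refine aemeasurable_of_tendsto_metrizable_ae Filter.atTop
      (f := fun n ω => ∑ i ∈ Finset.range n, x i * ω i) (fun n => Measurable.aemeasurable (by fun_prop)) ?_
    filter_upwards [hsum] with ω h using h.hasSum.tendsto_sum_nat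
  refine ⟨hm, ?_⟩
  have hqc := gaussianQ_cont
  have hlim : Filter.Tendsto
      (fun n : ℕ => ∫ ω, gaussianQ (b + ∑ i : Fin n, (a * x i) * (ω i - 1)) ∂ν) Filter.atTop
      (nhds (∫ ω, gaussianQ (b + a * ((∑' i, x i * ω i) - 1)) ∂ν)) := by
    refine tendsto_integral_of_dominated_convergence (fun _ => 1)
      (fun n => (hqc.measurable.comp (by fun_prop)).aestronglyMeasurable) (integrable_const 1)
      (fun n => Filter.Eventually.of_forall fun ω => gaussianQ_bound _) ?_
    filter_upwards [hsum] with ω h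
    refine (hqc.tendsto _).comp (Filter.Tendsto.const_add b ?_)
    have h2 := (h.hasSum.tendsto_sum_nat.sub hs.hasSum.tendsto_sum_nat).const_mul a
    rw [h1] at h2
    refine h2.congr fun n => ?_
    rw [Fin.sum_univ_eq_sum_range (fun i => a * x i * (ω i - 1)), ← Finset.sum_sub_distrib,
      Finset.mul_sum]
    exact Finset.sum_congr rfl fun i _ => by ring
  refine ge_of_tendsto' hlim fun n => ?_
  exact finite_lower (S := fun (i : Fin n) (ω : ℕ → ℝ) => ω i) (fun i => measurable_pi_apply _)
    (hI.precomp Fin.val_injective) (fun i => hl i) (fun i => a * x i)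
    (fun i => mul_nonneg ha.le (hx i)) b hb

lemma final_upper (hν : IsPiNat (fun _ => expMeasure 1) ν) (a b : ℝ) :
    Filter.Tendsto (fun n : ℕ =>
      ∫ ω, gaussianQ (b + a * ((∑ i ∈ Finset.range n, ω i) / n - 1)) ∂ν) Filter.atTop
      (nhds (gaussianQ b)) := by
  have := hν.1
  obtain ⟨hI, hl⟩ := pi_eq_inf hν
  have hqc := gaussianQ_cont
  have hint : Integrable (fun ω : ℕ → ℝ => ω 0) ν := by
    have := expMeasure_integrable
    rw [← hl 0] at this
    exact this.comp_measurable (measurable_pi_apply 0)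
  have hmean : ∫ ω, ω 0 ∂ν = 1 := by
    rw [← expMeasure_mean, ← hl 0, integral_map (measurable_pi_apply 0).aemeasurable (by fun_prop)]
  have hslln := strong_law_ae_real (fun i (ω : ℕ → ℝ) => ω i) hint
    (fun i j hij => hI.indepFun hij)
    (fun i => ⟨(measurable_pi_apply i).aemeasurable, (measurable_pi_apply 0).aemeasurable,
      by rw [hl i, hl 0]⟩)
  have : gaussianQ b = ∫ ω, gaussianQ b ∂ν := by simp
  rw [this]
  refine tendsto_integral_of_dominated_convergence (fun _ => 1)
      (fun n => (hqc.measurable.comp (by fun_prop)).aestronglyMeasurable) (integrable_const 1)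
      (fun n => Filter.Eventually.of_forall fun ω => gaussianQ_bound _) ?_
  filter_upwards [hslln] with ω h
  rw [hmean] at h
  have h2 := ((h.sub_const 1).const_mul a).const_add b
  simp only [sub_self, mul_zero, add_zero] at h2
  exact (hqc.tendsto _).comp h2

end final

theorem inf_exp_gaussian_probability
    (ν : Measure (ℕ → ℝ)) (hν : IsPiNat (fun _ => expMeasure 1) ν)
    (a b : ℝ) (ha : 0 < a) (hb : 0 < b) :
    (⨅ x : {x : ℕ → ℝ // (∀ i, 0 ≤ x i) ∧ Summable x ∧ ∑' i, x i = 1},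
        ((ν.prod (gaussianReal 0 1))
          {p | a * ((∑' i, x.1 i * p.1 i) - 1) ≤ p.2 - b}).toReal) = gaussianQ b := by
  have := hν.1
  have key : ∀ x : {x : ℕ → ℝ // (∀ i, 0 ≤ x i) ∧ Summable x ∧ ∑' i, x i = 1},
      ((ν.prod (gaussianReal 0 1))
          {p | a * ((∑' i, x.1 i * p.1 i) - 1) ≤ p.2 - b}).toReal =
      ∫ ω, gaussianQ (b + a * ((∑' i, x.1 i * ω i) - 1)) ∂ν := fun x =>
    prob_eq _ (final_lower hν a b ha hb x.1 x.2.1 x.2.2.1 x.2.2.2).1 a b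
  simp_rw [key]
  have hlow : ∀ x : {x : ℕ → ℝ // (∀ i, 0 ≤ x i) ∧ Summable x ∧ ∑' i, x i = 1},
      gaussianQ b ≤ ∫ ω, gaussianQ (b + a * ((∑' i, x.1 i * ω i) - 1)) ∂ν := fun x =>
    (final_lower hν a b ha hb x.1 x.2.1 x.2.2.1 x.2.2.2).2
  -- the averaging sequences
  have hxn : ∀ n : ℕ, 0 < n → ∃ x : {x : ℕ → ℝ // (∀ i, 0 ≤ x i) ∧ Summable x ∧ ∑' i, x i = 1},
      ∀ ω : ℕ → ℝ, ∑' i, x.1 i * ω i = (∑ i ∈ Finset.range n, ω i) / n := by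
    intro n hn
    have hs0 : ∀ i, i ∉ Finset.range n → (if i < n then (1 / n : ℝ) else 0) = 0 := by
      intro i hi
      simp only [Finset.mem_range] at hi
      simp [hi]
    refine ⟨⟨fun i => if i < n then (1 / n : ℝ) else 0, fun i => ?_,
      summable_of_ne_finset_zero hs0, ?_⟩, fun ω => ?_⟩
    · dsimp only
      split_ifs <;> positivity
    · rw [tsum_eq_sum hs0, Finset.sum_congr rfl
        (g := fun _ => (1 / n : ℝ)) (fun i hi => by simp [Finset.mem_range.1 hi])]
      simp
      field_simp
    · rw [tsum_eq_sum (s := Finset.range n) (fun i hi => by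
        simp only [hs0 i hi, zero_mul]), Finset.sum_div]
      refine Finset.sum_congr rfl fun i hi => ?_
      simp only [Finset.mem_range.1 hi, if_true]
      ring
  have hne : Nonempty {x : ℕ → ℝ // (∀ i, 0 ≤ x i) ∧ Summable x ∧ ∑' i, x i = 1} :=
    ⟨(hxn 1 one_pos).choose⟩
  refine le_antisymm ?_ (le_ciInf hlow)
  refine ge_of_tendsto (final_upper hν a b) ?_
  filter_upwards [Filter.eventually_gt_atTop 0] with n hn
  obtain ⟨x, hx⟩ := hxn n hn
  refine (ciInf_le ⟨gaussianQ b, ?_⟩ x).trans (le_of_eq ?_)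
  · rintro _ ⟨y, rfl⟩
    exact hlow y
  · simp_rw [hx]
end
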